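/- arXiv:1801.08460 — 14 statements merged into one kernel-verified Lean document; each statement's English description precedes it below -/
import Mathlib

section
/- Let p be a prime, n = r·k, let h : F_{p^k} → F_{p^k} be an arbitrary mapping, let γ ∈ F_{p^n}, γ ≠ 0, be an (i,b)-Frobenius translator of f : F_{p^n} → F_{p^k}, and let L : F_{p^n} → F_{p^n} be an F_{p^k}-linear bijection. Then the mapping G(x) = L(x)^{p^i} + L(γ)^{p^i}·h(f(x)) is a bijection of F_{p^n} if and only if the mapping g(u) = u + b·h(u) is a bijection of F_{p^k}. -/
/-- A finite field whose cardinality is a power of the prime `p` has characteristic `p`. -/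
theorem charP_of_card_eq_prime_pow_field {F : Type*} [Field F] [Fintype F] {p n : ℕ}
    (hp : p.Prime) (hF : Fintype.card F = p ^ n) : CharP F p := by
  rw [CharP.charP_iff_prime_eq_zero hp]
  have hzero : ((p ^ n : ℕ) : F) = 0 := by rw [← hF, Nat.cast_card_eq_zero]
  rw [Nat.cast_pow] at hzero
  exact eq_zero_of_pow_eq_zero hzero

/-- Every element fixed by the `p ^ k`-power map has a `p ^ i`-th root fixed by it, if `i ≤ k`. -/
theorem exists_pow_eq_of_pow_prime_pow_eq_self {M : Type*} [Monoid M] {p k i : ℕ} (hi : i ≤ k)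
    {w : M} (hw : w ^ p ^ k = w) : ∃ a : M, a ^ p ^ k = a ∧ a ^ p ^ i = w := by
  refine ⟨w ^ p ^ (k - i), ?_, ?_⟩
  · rw [← pow_mul, mul_comm, pow_mul, hw]
  · rw [← pow_mul, ← pow_add, Nat.sub_add_cancel hi, hw]

/-- Theorem on permutations from Frobenius translators.
Let `γ ≠ 0` be an `(i,b)`-Frobenius translator of `f : F_{p^n} → F_{p^k}`, let
`h : F_{p^k} → F_{p^k}` be arbitrary and `L : F_{p^n} → F_{p^n}` an `F_{p^k}`-linear
bijection. Then `G(x) = L(x)^{p^i} + L(γ)^{p^i} * h(f(x))` is a bijection of `F_{p^n}`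
iff `g(u) = u + b*h(u)` is a bijection of `F_{p^k}`.
The subfield `F_{p^k}` of `F = F_{p^n}` is identified with `{u : F | u ^ p ^ k = u}`. -/
theorem stmt_3 (p r k n : ℕ) (hp : p.Prime) (hk : 0 < k) (hn : n = r * k)
    (F : Type*) [Field F] [Fintype F] (hF : Fintype.card F = p ^ n)
    (f : F → F) (hf : ∀ x, f x ^ p ^ k = f x)
    (h : F → F) (hh : ∀ u : F, u ^ p ^ k = u → h u ^ p ^ k = h u)
    (i : ℕ) (hi : i < k)
    (γ : F) (hγ : γ ≠ 0) (b : F) (hb : b ^ p ^ k = b)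
    (htr : ∀ x u : F, u ^ p ^ k = u → f (x + u * γ) - f x = u ^ p ^ i * b)
    (L : F → F) (hLadd : ∀ x y, L (x + y) = L x + L y)
    (hLsmul : ∀ c x : F, c ^ p ^ k = c → L (c * x) = c * L x)
    (hLbij : Function.Bijective L) :
    Function.Bijective (fun x => L x ^ p ^ i + L γ ^ p ^ i * h (f x)) ↔
      Set.BijOn (fun u => u + b * h u) {u : F | u ^ p ^ k = u} {u : F | u ^ p ^ k = u} := by
  have : Fact p.Prime := ⟨hp⟩
  have : CharP F p := charP_of_card_eq_prime_pow_field hp hF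
  have root_sub : ∀ s t : F, s ^ p ^ k = s → t ^ p ^ k = t →
      ∃ a : F, a ^ p ^ k = a ∧ a ^ p ^ i = h t - h s := fun s t hs ht =>
    exists_pow_eq_of_pow_prime_pow_eq_self hi.le (by rw [sub_pow_char_pow, hh t ht, hh s hs])
  have L_translate : ∀ y a : F, a ^ p ^ k = a →
      L (y + a * γ) ^ p ^ i = L y ^ p ^ i + a ^ p ^ i * L γ ^ p ^ i := by
    intro y a ha
    rw [hLadd, hLsmul a γ ha, add_pow_char_pow, mul_pow]
  have g_mapsTo : Set.MapsTo (fun u => u + b * h u) {u : F | u ^ p ^ k = u}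
      {u : F | u ^ p ^ k = u} := by
    intro u hu
    simp only [Set.mem_ofPred_eq] at hu ⊢
    rw [add_pow_char_pow, mul_pow, hu, hb, hh u hu]
  constructor
  · intro hG
    refine (Set.toFinite _).injOn_iff_bijOn_of_mapsTo g_mapsTo |>.1 ?_
    intro s hs t ht hst
    simp only [Set.mem_ofPred_eq] at hs ht hst
    by_cases hb0 : b = 0
    · simpa [hb0] using hst
    obtain ⟨v, hv, hvi⟩ : ∃ v : F, v ^ p ^ k = v ∧ v ^ p ^ i = (t - f 0) / b :=
      exists_pow_eq_of_pow_prime_pow_eq_self hi.le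
        (by rw [div_pow, sub_pow_char_pow, ht, hf, hb])
    have hfy : f (0 + v * γ) = t := by
      have := htr 0 v hv
      rw [hvi, div_mul_cancel₀ _ hb0] at this
      linear_combination this
    obtain ⟨a, ha, hai⟩ := root_sub s t hs ht
    have hfx : f (0 + v * γ + a * γ) = s := by
      have := htr (0 + v * γ) a ha
      rw [hai, hfy] at this
      linear_combination this - hst
    have hxy : 0 + v * γ + a * γ = 0 + v * γ := by
      apply hG.injective
      simp only
      rw [hfx, hfy, L_translate _ a ha, hai]
      ring
    rw [← hfx, hxy, hfy]
  · intro hg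
    refine Finite.injective_iff_bijective.1 fun x y hxy => ?_
    obtain ⟨a, ha, hai⟩ := root_sub (f x) (f y) (hf x) (hf y)
    have hx : x = y + a * γ := by
      apply hLbij.injective
      apply iterateFrobenius_inj F p i
      simp only [iterateFrobenius_def]
      rw [L_translate y a ha, hai]
      linear_combination hxy
    have hfxy : f x = f y := by
      refine hg.injOn (hf x) (hf y) ?_
      have := htr y a ha
      rw [← hx, hai] at this
      linear_combination this
    have ha0 : a = 0 := by
      rw [hfxy, sub_self] at hai
      exact eq_zero_of_pow_eq_zero hai
    rw [hx, ha0, zero_mul, add_zero]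
end

section
/- Let p = 2, n = r·k, 1 ≤ ℓ ≤ r−1, and let f : F_{2^n} → F_{2^k} be defined by f(x) = T^n_k(x^{2^{ℓk}+1}). Then for γ ∈ F_{2^n} the identity f(x) + f(x + uγ) = u^2 · T^n_k(γ^{2^{ℓk}+1}) holds for all x ∈ F_{2^n} and all u ∈ F_{2^k} if and only if γ^{2^{ℓk}} + γ^{2^{n−ℓk}} = 0, equivalently γ^{2^{2ℓk}} = γ. -/
open Finset Polynomial

section RelTrace

variable {F : Type*} [Field F] (r k : ℕ)

/-- The relative trace `x ↦ ∑_{j<r} x^{2^{jk}}` from `F_{2^{rk}}` to `F_{2^k}`. -/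
def relTrace (x : F) : F := ∑ j ∈ range r, x ^ 2 ^ (j * k)

lemma relTrace_add [CharP F 2] (x y : F) :
    relTrace r k (x + y) = relTrace r k x + relTrace r k y := by
  simp only [relTrace, add_pow_char_pow, sum_add_distrib]

lemma pow_two_pow_mul_eq_self {u : F} (hu : u ^ 2 ^ k = u) (j : ℕ) : u ^ 2 ^ (j * k) = u := by
  induction j with
  | zero => simp
  | succ j ih => rw [Nat.succ_mul, pow_add, pow_mul, ih, hu]

lemma relTrace_mul_left {u : F} (hu : u ^ 2 ^ k = u) (x : F) :
    relTrace r k (u * x) = u * relTrace r k x := by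
  simp only [relTrace, mul_pow, pow_two_pow_mul_eq_self k hu, mul_sum]

lemma relTrace_pow_two_pow {x : F} (hx : x ^ 2 ^ (r * k) = x) (m : ℕ) :
    relTrace r k (x ^ 2 ^ (m * k)) = relTrace r k x := by
  have step (y : F) (hy : y ^ 2 ^ (r * k) = y) :
      relTrace r k (y ^ 2 ^ k) = relTrace r k y := by
    have h := (sum_range_succ' (fun j => y ^ 2 ^ (j * k)) r).symm.trans (sum_range_succ _ r)
    simp only [hy, zero_mul, pow_zero, pow_one, add_left_inj] at h
    simpa only [relTrace, ← pow_mul, ← pow_add, add_mul, one_mul, add_comm k] using h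
  induction m with
  | zero => simp
  | succ m ih =>
    rw [Nat.succ_mul, pow_add, pow_mul, step _ (by rw [pow_right_comm, hx]), ih]

lemma exists_relTrace_ne_zero [Fintype F] {r k : ℕ} (hk : 0 < k) (hr : 0 < r)
    (hF : Fintype.card F = 2 ^ (r * k)) : ∃ x : F, relTrace r k x ≠ 0 := by
  by_contra! h
  let P : F[X] := ∑ j ∈ range r, X ^ 2 ^ (j * k)
  have hP : P = 0 := by
    refine eq_zero_of_natDegree_lt_card_of_eval_eq_zero P Function.injective_id
      (fun x => by simpa [P, eval_finsetSum, relTrace] using h x) ?_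
    rw [hF]
    refine (natDegree_sum_le_of_forall_le (n := 2 ^ ((r - 1) * k)) _ _ fun j hj => ?_).trans_lt ?_
    · rw [natDegree_X_pow]
      have : j ≤ r - 1 := by have := mem_range.1 hj; omega
      gcongr
      norm_num
    · exact Nat.pow_lt_pow_right (by norm_num) (Nat.mul_lt_mul_of_pos_right (by omega) hk)
  have hc : P.coeff 1 = 1 := by
    simp only [P, finsetSum_coeff, coeff_X_pow]
    rw [sum_eq_single_of_mem 0 (mem_range.2 hr)]
    · simp
    · intro j _ hj
      exact if_neg (Nat.one_lt_two_pow (Nat.mul_ne_zero hj hk.ne')).ne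
  simp [hP] at hc

end RelTrace

/-- Example 1: For `p = 2`, `n = r*k`, `1 ≤ ℓ ≤ r-1` and
`f(x) = T^n_k(x^{2^{ℓk}+1})`, the identity
`f(x) + f(x + uγ) = u^2 * T^n_k(γ^{2^{ℓk}+1})` holds for all `x ∈ F_{2^n}` and all
`u ∈ F_{2^k}` iff `γ^{2^{ℓk}} + γ^{2^{n-ℓk}} = 0`, equivalently `γ^{2^{2ℓk}} = γ`.
The subfield `F_{2^k}` of `F = F_{2^n}` is identified with `{u : F | u ^ 2 ^ k = u}`,
and `T^n_k(β) = ∑_{j<r} β^{2^{jk}}`. -/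
theorem stmt_4 (r k n ℓ : ℕ) (hk : 0 < k) (hn : n = r * k) (hℓ1 : 1 ≤ ℓ) (hℓ2 : ℓ ≤ r - 1)
    (F : Type*) [Field F] [Fintype F] (hF : Fintype.card F = 2 ^ n)
    (f : F → F)
    (hf : ∀ x, f x = ∑ j ∈ Finset.range r, (x ^ (2 ^ (ℓ * k) + 1)) ^ 2 ^ (j * k))
    (γ : F) :
    ((∀ x u : F, u ^ 2 ^ k = u →
        f x + f (x + u * γ) =
          u ^ 2 * ∑ j ∈ Finset.range r, (γ ^ (2 ^ (ℓ * k) + 1)) ^ 2 ^ (j * k)) ↔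
      γ ^ 2 ^ (ℓ * k) + γ ^ 2 ^ (n - ℓ * k) = 0) ∧
    (γ ^ 2 ^ (ℓ * k) + γ ^ 2 ^ (n - ℓ * k) = 0 ↔ γ ^ 2 ^ (2 * ℓ * k) = γ) := by
  have hr : 0 < r := by omega
  have hlr : ℓ ≤ r := by omega
  subst hn
  have : CharP F 2 := charP_of_card_eq_prime_pow hF
  have hpow (x : F) : x ^ 2 ^ (r * k) = x := hF ▸ FiniteField.pow_card x
  have hsub : r * k - ℓ * k = (r - ℓ) * k := (Nat.sub_mul ..).symm
  have hround (x : F) : (x ^ 2 ^ (ℓ * k)) ^ 2 ^ ((r - ℓ) * k) = x := by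
    rw [← pow_mul, ← pow_add, ← add_mul, Nat.add_sub_cancel' hlr, hpow]
  rw [hsub]
  set Q := 2 ^ (ℓ * k) with hQ
  set δ := γ ^ Q + γ ^ 2 ^ ((r - ℓ) * k) with hδ
  have hcross (x : F) : relTrace r k (x ^ Q * γ + x * γ ^ Q) = relTrace r k (x * δ) := by
    rw [relTrace_add, ← relTrace_pow_two_pow r k (hpow (x ^ Q * γ)) (r - ℓ), mul_pow, hround,
      ← relTrace_add]
    congr 1
    ring
  have hexpand (x u : F) (hu : u ^ 2 ^ k = u) : f x + f (x + u * γ) =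
      u * relTrace r k (x * δ) + u ^ 2 * relTrace r k (γ ^ (Q + 1)) := by
    have hu2 : (u ^ 2) ^ 2 ^ k = u ^ 2 := by rw [pow_right_comm, hu]
    have hf' (y : F) : f y = relTrace r k (y ^ (Q + 1)) := hf y
    rw [hf', hf', ← relTrace_add, ← hcross, ← relTrace_mul_left r k hu,
      ← relTrace_mul_left r k hu2, ← relTrace_add]
    congr 1
    have h2 : x ^ (Q + 1) + x ^ (Q + 1) = 0 := CharTwo.add_self_eq_zero _
    rw [pow_succ (x + u * γ), hQ, add_pow_char_pow, mul_pow, pow_two_pow_mul_eq_self k hu, ← hQ]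
    linear_combination h2
  refine ⟨⟨fun h => ?_, fun h x u hu => ?_⟩, ?_⟩
  · by_contra hne
    obtain ⟨y, hy⟩ := exists_relTrace_ne_zero hk hr hF
    have h1 := h (y / δ) 1 (one_pow _)
    rw [hexpand _ _ (one_pow _), div_mul_cancel₀ _ hne] at h1
    exact hy (by simpa [relTrace] using h1)
  · rw [hexpand x u hu, h]
    simp [relTrace]
  · have hγ : (γ ^ 2 ^ ((r - ℓ) * k)) ^ Q = γ := by rw [pow_right_comm, hround]
    have hγ2 : (γ ^ Q) ^ Q = γ ^ 2 ^ (2 * ℓ * k) := by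
      rw [← pow_mul, hQ, ← pow_add, ← two_mul, mul_assoc]
    rw [hδ, CharTwo.add_eq_zero, ← hγ2]
    refine ⟨fun h => by rw [h, hγ], fun h => ?_⟩
    calc γ ^ Q = ((γ ^ Q) ^ Q) ^ 2 ^ ((r - ℓ) * k) := (hround _).symm
      _ = _ := by rw [h]
end

section
/- Let p be an odd prime, n = 4k, and let f : F_{p^n} → F_{p^{2k}} be defined by f(x) = T^n_k(x) + T^n_{2k}(x). If γ ∈ F_{p^n}, γ ≠ 0, satisfies γ + γ^{p^{2k}} = 0, then γ is a 0-linear translator of f, i.e., f(x + uγ) − f(x) = 0 for all x ∈ F_{p^n} and all u ∈ F_{p^{2k}}. Moreover, for any γ ∈ F_{p^n} and any x ∈ F_{p^n}, u ∈ F_{p^{2k}}, one has f(x + uγ) − f(x) = 2u(γ + γ^{p^{2k}}) + u^{p^k}(γ^{p^k} + γ^{p^{3k}}). -/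
/-- For odd `p`, `n = 4k` and `f(x) = T^n_k(x) + T^n_{2k}(x)`
(a map `F_{p^n} → F_{p^{2k}}`): any nonzero `γ` with `γ + γ^{p^{2k}} = 0` is a
`0`-linear translator of `f`, and in general
`f(x + uγ) - f(x) = 2u(γ + γ^{p^{2k}}) + u^{p^k}(γ^{p^k} + γ^{p^{3k}})`
for all `x ∈ F_{p^n}` and `u ∈ F_{p^{2k}}`.
The subfield `F_{p^{2k}}` of `F = F_{p^n}` is `{u : F | u ^ p ^ (2*k) = u}`;
`T^n_k(x) = ∑_{j<4} x^{p^{jk}}` and `T^n_{2k}(x) = x + x^{p^{2k}}`. -/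
theorem stmt_5 (p k n : ℕ) (hp : p.Prime) (hp2 : p ≠ 2) (hk : 0 < k) (hn : n = 4 * k)
    (F : Type*) [Field F] [Fintype F] (hF : Fintype.card F = p ^ n)
    (f : F → F)
    (hf : ∀ x, f x = (∑ j ∈ Finset.range 4, x ^ p ^ (j * k)) +
        (∑ j ∈ Finset.range 2, x ^ p ^ (j * (2 * k)))) :
    (∀ γ : F, γ ≠ 0 → γ + γ ^ p ^ (2 * k) = 0 →
      ∀ x u : F, u ^ p ^ (2 * k) = u → f (x + u * γ) - f x = 0) ∧
    (∀ γ x u : F, u ^ p ^ (2 * k) = u →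
      f (x + u * γ) - f x =
        2 * u * (γ + γ ^ p ^ (2 * k)) + u ^ p ^ k * (γ ^ p ^ k + γ ^ p ^ (3 * k))) := by
  have : Fact p.Prime := ⟨hp⟩
  have : CharP F p := charP_of_card_eq_prime_pow hF
  have diff_formula : ∀ γ x u : F, u ^ p ^ (2 * k) = u →
      f (x + u * γ) - f x =
        2 * u * (γ + γ ^ p ^ (2 * k)) + u ^ p ^ k * (γ ^ p ^ k + γ ^ p ^ (3 * k)) := by
    intro γ x u hu
    have hu_three : u ^ p ^ (3 * k) = u ^ p ^ k := by
      rw [show 3 * k = 2 * k + k by ring, pow_add, pow_mul, hu]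
    simp only [hf, Finset.sum_range_succ, Finset.sum_range_zero, add_pow_char_pow, mul_pow,
      zero_mul, one_mul, pow_zero, pow_one, hu, hu_three]
    ring
  refine ⟨fun γ _ hγ x u hu => ?_, diff_formula⟩
  have hγ_frob : γ ^ p ^ k + γ ^ p ^ (3 * k) = 0 := by
    rw [show 3 * k = 2 * k + k by ring, pow_add, pow_mul, ← add_pow_char_pow, hγ,
      zero_pow (pow_ne_zero k hp.ne_zero)]
  rw [diff_formula γ x u hu, hγ, hγ_frob, mul_zero, mul_zero, add_zero]
end

section
/- Let p = 2, n = 4k, and let f : F_{2^n} → F_{2^{2k}} be defined by f(x) = T^n_k(x) + T^n_{2k}(x). Then every nonzero γ ∈ F_{2^n} is a (k, γ^{2^k} + γ^{2^{3k}})-Frobenius translator of f, i.e., f(x + uγ) − f(x) = u^{2^k}·(γ^{2^k} + γ^{2^{3k}}) for all x ∈ F_{2^n} and all u ∈ F_{2^{2k}}. -/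
/-- For `p = 2`, `n = 4k` and `f(x) = T^n_k(x) + T^n_{2k}(x)`
(a map `F_{2^n} → F_{2^{2k}}`), every nonzero `γ ∈ F_{2^n}` is a
`(k, γ^{2^k} + γ^{2^{3k}})`-Frobenius translator of `f`, i.e.
`f(x + uγ) - f(x) = u^{2^k} * (γ^{2^k} + γ^{2^{3k}})` for all `x ∈ F_{2^n}` and all
`u ∈ F_{2^{2k}}`.
The subfield `F_{2^{2k}}` of `F = F_{2^n}` is `{u : F | u ^ 2 ^ (2*k) = u}`;
`T^n_k(x) = ∑_{j<4} x^{2^{jk}}` and `T^n_{2k}(x) = x + x^{2^{2k}}`. -/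
theorem stmt_6 (k n : ℕ) (hk : 0 < k) (hn : n = 4 * k)
    (F : Type*) [Field F] [Fintype F] (hF : Fintype.card F = 2 ^ n)
    (f : F → F)
    (hf : ∀ x, f x = (∑ j ∈ Finset.range 4, x ^ 2 ^ (j * k)) +
        (∑ j ∈ Finset.range 2, x ^ 2 ^ (j * (2 * k)))) :
    ∀ γ : F, γ ≠ 0 → ∀ x u : F, u ^ 2 ^ (2 * k) = u →
      f (x + u * γ) - f x = u ^ 2 ^ k * (γ ^ 2 ^ k + γ ^ 2 ^ (3 * k)) := by
  intro γ _ x u hu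
  have : Fact (Nat.Prime 2) := ⟨Nat.prime_two⟩
  have : CharP F 2 := charP_of_card_eq_prime_pow hF
  have hf_eq : ∀ y, f y = y ^ 2 ^ k + y ^ 2 ^ (3 * k) := by
    intro y
    rw [hf]
    simp only [Finset.sum_range_succ, Finset.sum_range_zero, zero_mul, one_mul, pow_zero, pow_one]
    linear_combination (y + y ^ 2 ^ (2 * k)) * CharTwo.two_eq_zero (R := F)
  have hu_three : u ^ 2 ^ (3 * k) = u ^ 2 ^ k := by
    rw [show 3 * k = 2 * k + k by ring, pow_add, pow_mul, hu]
  rw [hf_eq, hf_eq, add_pow_char_pow, add_pow_char_pow, mul_pow, mul_pow, hu_three]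
  ring
end

section
/- Let p be a prime, n = r·k with r > 1, and let d be a positive integer such that x^d ∈ F_{p^k} for all x ∈ F_{p^n}, so that f(x) = x^d defines a function f : F_{p^n} → F_{p^k}. Then f has no Frobenius translator: there exist no nonzero γ ∈ F_{p^n}, b ∈ F_{p^k}, and integer i with 0 ≤ i ≤ k−1 such that f(x + uγ) − f(x) = u^{p^i}·b for all x ∈ F_{p^n} and all u ∈ F_{p^k}. -/
open Polynomial in
/-- A finite field all of whose elements satisfy `x ^ q = x` with `1 < q` has at most `q` elements. -/
theorem card_le_of_forall_pow_eq {F : Type*} [Field F] [Fintype F] {q : ℕ} (hq : 1 < q)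
    (h : ∀ x : F, x ^ q = x) : Fintype.card F ≤ q := by
  rw [← FiniteField.X_pow_card_sub_X_natDegree_eq F hq]
  exact Polynomial.card_le_degree_of_subset_roots (Z := Finset.univ) fun x _ =>
    (mem_roots (FiniteField.X_pow_card_sub_X_ne_zero F hq)).2 (by simp [h x])

/-- For `n = r*k` with `r > 1` and a positive integer `d` such that
`f(x) = x^d` maps `F_{p^n}` into the subfield `F_{p^k}`, the function `f` has no
Frobenius translator: there are no nonzero `γ ∈ F_{p^n}`, `b ∈ F_{p^k}` and
`0 ≤ i ≤ k-1` with `f(x + uγ) - f(x) = u^{p^i} * b` for all `x ∈ F_{p^n}`, `u ∈ F_{p^k}`.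
The subfield `F_{p^k}` of `F = F_{p^n}` is identified with `{u : F | u ^ p ^ k = u}`. -/
theorem stmt_7 (p r k n d : ℕ) (hp : p.Prime) (hk : 0 < k) (hr : 1 < r) (hn : n = r * k)
    (hd : 0 < d)
    (F : Type*) [Field F] [Fintype F] (hF : Fintype.card F = p ^ n)
    (hsub : ∀ x : F, (x ^ d) ^ p ^ k = x ^ d) :
    ¬ ∃ (γ b : F) (i : ℕ), γ ≠ 0 ∧ b ^ p ^ k = b ∧ i < k ∧
      ∀ x u : F, u ^ p ^ k = u → (x + u * γ) ^ d - x ^ d = u ^ p ^ i * b := by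
  rintro ⟨γ, b, i, hγ, -, hi, h⟩
  have := Fact.mk hp
  have : CharP F p := charP_of_card_eq_prime_pow hF
  have hq : 1 < p ^ k := Nat.one_lt_pow hk.ne' hp.one_lt
  have hγb : γ ^ d = b := by simpa [hd.ne'] using h 0 1 (one_pow _)
  have hfix : ∀ y : F, y ^ p ^ k = y := by
    intro y
    -- `u` is the element of the subfield with `u ^ p ^ i = -y ^ d`
    set u : F := (-y ^ d) ^ p ^ (k - i) with hu
    have hneg : (-y ^ d) ^ p ^ k = -y ^ d := by
      rw [neg_pow, neg_one_pow_char_pow, hsub, neg_one_mul]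
    have hu_fix : u ^ p ^ k = u := by
      rw [hu, ← pow_mul, mul_comm, pow_mul, hneg]
    have hu_pow : u ^ p ^ i = -y ^ d := by
      rw [hu, ← pow_mul, ← pow_add, Nat.sub_add_cancel hi.le, hneg]
    have hzero : (y * γ + u * γ) ^ d = 0 := by
      have := h (y * γ) u hu_fix
      rw [hu_pow, mul_pow, hγb] at this
      linear_combination this
    have hy : y = -u := by
      rw [← add_mul] at hzero
      exact eq_neg_of_add_eq_zero_left
        ((mul_eq_zero.1 (eq_zero_of_pow_eq_zero hzero)).resolve_right hγ)
    rw [hy, neg_pow, neg_one_pow_char_pow, hu_fix, neg_one_mul]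
  have hle := card_le_of_forall_pow_eq hq hfix
  rw [hF, Nat.pow_le_pow_iff_right hp.one_lt, hn] at hle
  nlinarith
end

section
/- Let p = 2, n = r·k with r > 1, let 0 < l < r and i ≥ 0 be integers, let β ∈ F_{2^k} be nonzero, and define f : F_{2^n} → F_{2^k} by f(x) = T^n_k(β·x^{2^i + 2^{i+kl}}). If r is even, then γ = 1 is a 0-translator of f, i.e., f(x + u) = f(x) for all x ∈ F_{2^n} and all u ∈ F_{2^k}. If r is odd, then γ = 1 is an (i+1, β)-Frobenius translator of f, i.e., f(x + u) − f(x) = u^{2^{i+1}}·β for all x ∈ F_{2^n} and all u ∈ F_{2^k}. -/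
open Finset

/-- An element fixed by `y ↦ y ^ q ^ k` is fixed by all iterates of this map. -/
lemma pow_pow_mul_eq_self {M : Type*} [Monoid M] {q k : ℕ} {c : M} (hc : c ^ q ^ k = c) (j : ℕ) :
    c ^ q ^ (j * k) = c := by
  induction j with
  | zero => simp
  | succ j ih => rw [add_mul, one_mul, pow_add, pow_mul, ih, hc]

/-- The relative trace is linear over the elements fixed by `y ↦ y ^ q ^ k`. -/
lemma sum_mul_pow_pow_of_fixed {R : Type*} [CommSemiring R] {q k : ℕ} {c : R}
    (hc : c ^ q ^ k = c) (r : ℕ) (y : R) :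
    ∑ j ∈ range r, (c * y) ^ q ^ (j * k) = c * ∑ j ∈ range r, y ^ q ^ (j * k) := by
  simp only [mul_pow, pow_pow_mul_eq_self hc, mul_sum]

/-- The relative trace is additive in characteristic `p`. -/
lemma sum_add_pow_pow {R : Type*} [CommSemiring R] (p : ℕ) [ExpChar R p] (k r : ℕ) (x y : R) :
    ∑ j ∈ range r, (x + y) ^ p ^ (j * k) =
      ∑ j ∈ range r, x ^ p ^ (j * k) + ∑ j ∈ range r, y ^ p ^ (j * k) := by
  simp only [add_pow_expChar_pow, sum_add_distrib]

/-- The relative trace is invariant under `y ↦ y ^ q ^ (k * l)`. -/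
lemma sum_pow_pow_mul_pow {R : Type*} [Ring R] {q k r : ℕ} (h : ∀ y : R, y ^ q ^ (r * k) = y)
    (l : ℕ) (y : R) :
    ∑ j ∈ range r, (y ^ q ^ (k * l)) ^ q ^ (j * k) = ∑ j ∈ range r, y ^ q ^ (j * k) := by
  induction l with
  | zero => simp
  | succ l ih =>
    rw [← ih]
    set z := y ^ q ^ (k * l)
    have hz : y ^ q ^ (k * (l + 1)) = z ^ q ^ k := by
      rw [mul_add, mul_one, pow_add, pow_mul]
    have hshift : ∀ j, (z ^ q ^ k) ^ q ^ (j * k) = z ^ q ^ ((j + 1) * k) := fun j => by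
      rw [← pow_mul, ← pow_add]
      ring_nf
    simp only [hz, hshift]
    have key := (sum_range_succ' (fun j => z ^ q ^ (j * k)) r).symm.trans
      (sum_range_succ (fun j => z ^ q ^ (j * k)) r)
    simpa [h] using key

/-- In characteristic two, translating `x ↦ T(β x ^ (2 ^ i + 2 ^ (i + k l)))` by a fixed element
`u` of `y ↦ y ^ 2 ^ k` adds the constant `r β u ^ 2 ^ (i + 1)`. -/
lemma sum_translate_eq_add {R : Type*} [CommRing R] [CharP R 2] {k r : ℕ}
    (h : ∀ y : R, y ^ 2 ^ (r * k) = y) (i l : ℕ) {β u : R}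
    (hβ : β ^ 2 ^ k = β) (hu : u ^ 2 ^ k = u) (x : R) :
    ∑ j ∈ range r, (β * (x + u) ^ (2 ^ i + 2 ^ (i + k * l))) ^ 2 ^ (j * k) =
      ∑ j ∈ range r, (β * x ^ (2 ^ i + 2 ^ (i + k * l))) ^ 2 ^ (j * k) +
        r * (u ^ 2 ^ (i + 1) * β) := by
  have : ExpChar R 2 := .prime Nat.prime_two
  have hv : (u ^ 2 ^ i) ^ 2 ^ k = u ^ 2 ^ i := by rw [pow_right_comm, hu]
  have hvQ : (u ^ 2 ^ i) ^ 2 ^ (k * l) = u ^ 2 ^ i := by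
    rw [mul_comm k l, pow_pow_mul_eq_self hv]
  have hsplit : ∀ y : R, y ^ (2 ^ i + 2 ^ (i + k * l)) =
      y ^ 2 ^ i * (y ^ 2 ^ i) ^ 2 ^ (k * l) := fun y => by
    rw [pow_add, pow_add 2 i, pow_mul]
  have hu2 : u ^ 2 ^ (i + 1) = u ^ 2 ^ i * u ^ 2 ^ i := by
    rw [pow_succ, pow_mul, sq]
  simp only [hsplit, add_pow_expChar_pow, hvQ, hu2]
  generalize x ^ 2 ^ i = a
  generalize u ^ 2 ^ i = v at hv
  have hexpand : (a + v) * (a ^ 2 ^ (k * l) + v) =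
      a * a ^ 2 ^ (k * l) + (v * (a + a ^ 2 ^ (k * l)) + v * v * 1) := by ring
  have hvv : (v * v) ^ 2 ^ k = v * v := by rw [mul_pow, hv]
  simp only [sum_mul_pow_pow_of_fixed hβ, hexpand, sum_add_pow_pow 2,
    sum_mul_pow_pow_of_fixed hv, sum_mul_pow_pow_of_fixed hvv, sum_pow_pow_mul_pow h,
    CharTwo.add_self_eq_zero]
  simp only [one_pow, sum_const, card_range, nsmul_eq_mul]
  ring

/-- For `p = 2`, `n = r*k` (`r > 1`), `0 < l < r`, `i ≥ 0`, nonzero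
`β ∈ F_{2^k}` and `f(x) = T^n_k(β x^{2^i + 2^{i+kl}})`: if `r` is even then `γ = 1`
is a `0`-translator of `f` (`f(x+u) = f(x)` for all `x ∈ F_{2^n}`, `u ∈ F_{2^k}`);
if `r` is odd then `γ = 1` is an `(i+1, β)`-Frobenius translator
(`f(x+u) - f(x) = u^{2^{i+1}} β`).
The subfield `F_{2^k}` of `F = F_{2^n}` is `{u : F | u ^ 2 ^ k = u}`, and
`T^n_k(y) = ∑_{j<r} y^{2^{jk}}`. -/
theorem stmt_10 (r k n l i : ℕ) (hk : 0 < k) (hr : 1 < r) (hn : n = r * k)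
    (hl1 : 0 < l) (hl2 : l < r)
    (F : Type*) [Field F] [Fintype F] (hF : Fintype.card F = 2 ^ n)
    (β : F) (hβ0 : β ≠ 0) (hβ : β ^ 2 ^ k = β)
    (f : F → F)
    (hf : ∀ x, f x = ∑ j ∈ Finset.range r, (β * x ^ (2 ^ i + 2 ^ (i + k * l))) ^ 2 ^ (j * k)) :
    (Even r → ∀ x u : F, u ^ 2 ^ k = u → f (x + u) = f x) ∧
    (Odd r → ∀ x u : F, u ^ 2 ^ k = u → f (x + u) - f x = u ^ 2 ^ (i + 1) * β) := by
  have : Fact (Nat.Prime 2) := ⟨Nat.prime_two⟩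
  have : CharP F 2 := charP_of_card_eq_prime_pow hF
  have hcard : ∀ y : F, y ^ 2 ^ (r * k) = y := fun y => by
    rw [← hn, ← hF, FiniteField.pow_card]
  refine ⟨fun he x u hu => ?_, fun ho x u hu => ?_⟩
  · rw [hf, hf, sum_translate_eq_add hcard i l hβ hu, CharTwo.natCast_eq_ite, if_pos he, zero_mul,
      add_zero]
  · rw [hf, hf, sum_translate_eq_add hcard i l hβ hu, CharTwo.natCast_eq_ite,
      if_neg (Nat.not_even_iff_odd.mpr ho), one_mul, add_sub_cancel_left]
end

section
/- Let p be an odd prime, n = r·k with r > 1, let 0 < l < r and i ≥ 0 be integers, let β ∈ F_{p^n} be nonzero, and define f : F_{p^n} → F_{p^k} by f(x) = T^n_k(β·x^{p^i + p^{i+kl}}). If γ ∈ F_{p^n}, γ ≠ 0, is an (s,b)-Frobenius translator of f for some s and some b ∈ F_{p^k}, then necessarily b = 0. -/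
/-- For odd `p`, `n = r*k` (`r > 1`), `0 < l < r`, `i ≥ 0`, nonzero
`β ∈ F_{p^n}` and `f(x) = T^n_k(β x^{p^i + p^{i+kl}})`: if a nonzero `γ ∈ F_{p^n}`
is an `(s,b)`-Frobenius translator of `f` (with `b ∈ F_{p^k}`), then `b = 0`.
The subfield `F_{p^k}` of `F = F_{p^n}` is `{u : F | u ^ p ^ k = u}`, and
`T^n_k(y) = ∑_{j<r} y^{p^{jk}}`. -/
theorem stmt_11 (p r k n l i : ℕ) (hp : p.Prime) (hp2 : p ≠ 2) (hk : 0 < k) (hr : 1 < r)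
    (hn : n = r * k) (hl1 : 0 < l) (hl2 : l < r)
    (F : Type*) [Field F] [Fintype F] (hF : Fintype.card F = p ^ n)
    (β : F) (hβ0 : β ≠ 0)
    (f : F → F)
    (hf : ∀ x, f x = ∑ j ∈ Finset.range r, (β * x ^ (p ^ i + p ^ (i + k * l))) ^ p ^ (j * k))
    (γ : F) (hγ : γ ≠ 0) (s : ℕ) (hs : s < k) (b : F) (hb : b ^ p ^ k = b)
    (htr : ∀ x u : F, u ^ p ^ k = u → f (x + u * γ) - f x = u ^ p ^ s * b) :
    b = 0 := by
  have hodd : Odd p := hp.odd_of_ne_two hp2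
  have hchar : ringChar F ≠ 2 := fun h => by
    have heven : Fintype.card F % 2 = 0 := FiniteField.even_card_of_char_two h
    rw [hF, ← Nat.even_iff] at heven
    exact Nat.not_even_iff_odd.mpr hodd.pow heven
  -- The exponent `p ^ i + p ^ (i + k * l)` is even, so `f` is an even function.
  have hfeven : f (-γ) = f γ := by
    simp only [hf, (hodd.pow.add_odd hodd.pow : Even (p ^ i + p ^ (i + k * l))).neg_pow]
  have hpos := htr 0 1 (one_pow _)
  have hneg := htr 0 (-1) hodd.pow.neg_one_pow
  rw [zero_add, one_mul, one_pow, one_mul] at hpos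
  rw [zero_add, neg_one_mul, hodd.pow.neg_one_pow, neg_one_mul, hfeven, hpos] at hneg
  exact (Ring.eq_self_iff_eq_zero_of_char_ne_two hchar).mp hneg.symm
end

section
/- Let p be an odd prime, n = 2k, and let S = { y ∈ F_{p^n} : T^n_k(y) = 0 }. Let L(x) = Σ_{i} λ_i x^{p^i} with all λ_i ∈ F_{p^k} be a linearized polynomial that permutes F_{p^n}, let δ ∈ S, and let s be an even integer with 2 ≤ s ≤ p^n − 1. Then the mapping G(x) = −L(x) + (x+δ)^s − (x+δ)^{p^k·s} permutes the set S (in fact G(x) = −L(x) for all x ∈ S), and consequently F(x) = L(x) + (x^{p^k} − x + δ)^s is a permutation of F_{p^n}. -/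
/-- A linearized polynomial whose coefficients are fixed by the Frobenius power `x ↦ x ^ p ^ k`
commutes with it. -/
theorem linearized_pow_comm {F : Type*} [Field F] (p k : ℕ) [ExpChar F p]
    (m : ℕ) (lam : ℕ → F) (hlam : ∀ j, lam j ^ p ^ k = lam j) (x : F) :
    (∑ j ∈ Finset.range m, lam j * x ^ p ^ j) ^ p ^ k =
      ∑ j ∈ Finset.range m, lam j * (x ^ p ^ k) ^ p ^ j := by
  rw [sum_pow_char_pow]
  refine Finset.sum_congr rfl fun j _ => ?_
  rw [mul_pow, hlam, ← pow_mul, ← pow_mul, mul_comm (p ^ j)]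

/-- Linearized polynomials respect subtraction. -/
theorem linearized_sub {F : Type*} [Field F] (p : ℕ) [ExpChar F p]
    (m : ℕ) (lam : ℕ → F) (x y : F) :
    ∑ j ∈ Finset.range m, lam j * (x - y) ^ p ^ j =
      ∑ j ∈ Finset.range m, lam j * x ^ p ^ j - ∑ j ∈ Finset.range m, lam j * y ^ p ^ j := by
  simp only [sub_pow_expChar_pow, mul_sub, Finset.sum_sub_distrib]

/-- Proposition on permuting the subspace S, δ ∈ S.
Let `p` be odd, `n = 2k`, `S = {y : T^n_k(y) = 0}` (where `T^n_k(y) = y + y^{p^k}`),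
let `L(x) = ∑ λ_i x^{p^i}` with all `λ_i ∈ F_{p^k}` be a linearized permutation of
`F_{p^n}`, let `δ ∈ S` and let `s` be even with `2 ≤ s ≤ p^n - 1`. Then
`G(x) = -L(x) + (x+δ)^s - (x+δ)^{p^k s}` permutes `S` (in fact `G(x) = -L(x)` on `S`),
and `F(x) = L(x) + (x^{p^k} - x + δ)^s` is a permutation of `F_{p^n}`. -/
theorem stmt_12 (p k n : ℕ) (hp : p.Prime) (hp2 : p ≠ 2) (hk : 0 < k) (hn : n = 2 * k)
    (F : Type*) [Field F] [Fintype F] (hF : Fintype.card F = p ^ n)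
    (m : ℕ) (lam : ℕ → F) (hlam : ∀ j, lam j ^ p ^ k = lam j)
    (L : F → F) (hL : ∀ x, L x = ∑ j ∈ Finset.range m, lam j * x ^ p ^ j)
    (hLbij : Function.Bijective L)
    (δ : F) (hδ : δ + δ ^ p ^ k = 0)
    (s : ℕ) (hs1 : 2 ≤ s) (hs2 : s ≤ p ^ n - 1) (hse : Even s) :
    (∀ x : F, x + x ^ p ^ k = 0 →
      -L x + (x + δ) ^ s - (x + δ) ^ (p ^ k * s) = -L x) ∧
    Set.BijOn (fun x => -L x + (x + δ) ^ s - (x + δ) ^ (p ^ k * s))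
      {y : F | y + y ^ p ^ k = 0} {y : F | y + y ^ p ^ k = 0} ∧
    Function.Bijective (fun x => L x + (x ^ p ^ k - x + δ) ^ s) := by
  have : Fact p.Prime := ⟨hp⟩
  have : CharP F p := charP_of_card_eq_prime_pow (f := n) hF
  have hLpow (x : F) : L x ^ p ^ k = L (x ^ p ^ k) := by
    rw [hL, hL, linearized_pow_comm p k m lam hlam]
  have hLsub (x y : F) : L (x - y) = L x - L y := by
    rw [hL, hL, hL, linearized_sub]
  have hL0 : L 0 = 0 := by simpa using hLsub 0 0
  have hLneg (x : F) : L (-x) = -L x := by simpa [hL0] using hLsub 0 x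
  have hfrob (x : F) : (x ^ p ^ k) ^ p ^ k = x := by
    rw [← pow_mul, ← pow_add, ← two_mul, ← hn, ← hF, FiniteField.pow_card]
  have heven (z : F) (hz : z + z ^ p ^ k = 0) : z ^ (p ^ k * s) = z ^ s := by
    rw [pow_mul, eq_neg_of_add_eq_zero_right hz, hse.neg_pow]
  have hG (x : F) (hx : x + x ^ p ^ k = 0) :
      -L x + (x + δ) ^ s - (x + δ) ^ (p ^ k * s) = -L x := by
    rw [heven (x + δ) (by rw [add_pow_expChar_pow]; linear_combination hx + hδ)]
    ring
  refine ⟨hG, ?_, Finite.injective_iff_bijective.mp fun x y hxy => ?_⟩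
  · have hmaps : Set.MapsTo (fun x => -L x) {y : F | y + y ^ p ^ k = 0}
        {y : F | y + y ^ p ^ k = 0} := by
      intro x hx
      have hx' : x ^ p ^ k = -x := eq_neg_of_add_eq_zero_right hx
      change -L x + (-L x) ^ p ^ k = 0
      rw [← hLneg, hLpow, ← hx', hfrob, hx', hLneg, neg_add_cancel]
    have hbij := ((Set.toFinite _).injOn_iff_bijOn_of_mapsTo hmaps).mp
      (neg_injective.comp hLbij.injective).injOn
    exact hbij.congr fun x hx => (hG x hx).symm
  · have hdiff (x : F) : (L x + (x ^ p ^ k - x + δ) ^ s) ^ p ^ k -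
        (L x + (x ^ p ^ k - x + δ) ^ s) = L (x ^ p ^ k - x) := by
      have hz : (x ^ p ^ k - x + δ) + (x ^ p ^ k - x + δ) ^ p ^ k = 0 := by
        rw [add_pow_expChar_pow, sub_pow_expChar_pow, hfrob]
        linear_combination hδ
      rw [add_pow_expChar_pow, ← pow_mul, mul_comm s, heven _ hz, hLpow, hLsub]
      ring
    have hd : x ^ p ^ k - x = y ^ p ^ k - y := by
      apply hLbij.injective
      rw [← hdiff x, ← hdiff y]
      exact congrArg (fun w => w ^ p ^ k - w) hxy
    apply hLbij.injective
    simpa [hd] using hxy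
end

section
/- Let p be an odd prime and n = 2k. Let L(x) = Σ_{i} λ_i x^{p^i} with all λ_i ∈ F_{p^k} be a linearized polynomial that permutes F_{p^n}. Then for any δ ∈ F_{p^n} and any nonnegative integer t, the mapping F(x) = L(x) + (x^{p^k} − x + δ)^{t(p^k+1)} is a permutation of F_{p^n}. (In fact, x^{t(p^k+1)} − x^{p^k·t(p^k+1)} = 0 for every x ∈ F_{p^n}.) -/
/-- Proposition on permutations with exponent t(p^k+1).
Let `p` be odd, `n = 2k`, and let `L(x) = ∑ λ_i x^{p^i}` with all `λ_i ∈ F_{p^k}`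
be a linearized permutation of `F_{p^n}`. Then for any `δ ∈ F_{p^n}` and any `t ≥ 0`,
`F(x) = L(x) + (x^{p^k} - x + δ)^{t(p^k+1)}` is a permutation of `F_{p^n}`; moreover
`x^{t(p^k+1)} - x^{p^k t (p^k+1)} = 0` for every `x ∈ F_{p^n}`. -/
theorem stmt_13 (p k n : ℕ) (hp : p.Prime) (hp2 : p ≠ 2) (hk : 0 < k) (hn : n = 2 * k)
    (F : Type*) [Field F] [Fintype F] (hF : Fintype.card F = p ^ n)
    (m : ℕ) (lam : ℕ → F) (hlam : ∀ j, lam j ^ p ^ k = lam j)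
    (L : F → F) (hL : ∀ x, L x = ∑ j ∈ Finset.range m, lam j * x ^ p ^ j)
    (hLbij : Function.Bijective L)
    (δ : F) (t : ℕ) :
    Function.Bijective (fun x => L x + (x ^ p ^ k - x + δ) ^ (t * (p ^ k + 1))) ∧
    ∀ x : F, x ^ (t * (p ^ k + 1)) - x ^ (p ^ k * (t * (p ^ k + 1))) = 0 := by
  have : Fact p.Prime := ⟨hp⟩
  have : CharP F p := charP_of_card_eq_prime_pow hF
  have frob_frob (x : F) : (x ^ p ^ k) ^ p ^ k = x := by
    rw [← pow_mul, ← pow_add, ← two_mul, ← hn, ← hF, FiniteField.pow_card]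
  have norm_fixed (x : F) : (x ^ (t * (p ^ k + 1))) ^ p ^ k = x ^ (t * (p ^ k + 1)) := by
    rw [pow_right_comm, mul_comm t, pow_mul, pow_mul, pow_succ, pow_succ, frob_frob, mul_comm]
  have L_sub (x y : F) : L (x - y) = L x - L y := by
    simp only [hL, sub_pow_char_pow, mul_sub, Finset.sum_sub_distrib]
  have L_frob (x : F) : L (x ^ p ^ k) = L x ^ p ^ k := by
    rw [hL, hL, sum_pow_char_pow]
    refine Finset.sum_congr rfl fun j _ => ?_
    rw [mul_pow, hlam, pow_right_comm]
  refine ⟨Finite.injective_iff_bijective.mp fun x y hxy => ?_, fun x => ?_⟩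
  · have hxy_frob := congrArg (· ^ p ^ k) hxy
    simp only [add_pow_char_pow, norm_fixed, ← L_frob] at hxy_frob
    have frob_sub_eq : x ^ p ^ k - x = y ^ p ^ k - y := hLbij.injective <| by
      rw [L_sub, L_sub]
      linear_combination hxy_frob - hxy
    rw [frob_sub_eq] at hxy
    exact hLbij.injective (add_right_cancel hxy)
  · rw [mul_comm (p ^ k), pow_mul x _ (p ^ k), norm_fixed, sub_self]
end

section
/- Let p = 2, n = r·k, let f : F_{2^n} → F_{2^k}, let L : F_{2^n} → F_{2^n} be an F_{2^k}-linear bijection, let g : F_{2^k} → F_{2^k} be a bijection, and let γ ∈ F_{2^n}, γ ≠ 0, be an (i,a)-Frobenius translator of f, where a ∈ F_{2^k} is nonzero. Then the mapping φ(x) = L(x) + L(γ)·( g(f(x)) + f(x)/a )^{2^{n−i}} is a permutation of F_{2^n}, and its inverse is φ^{−1}(x) = L^{−1}(x) + γ·a^{−2^{n−i}}·( g^{−1}( f(L^{−1}(x))/a ) + f(L^{−1}(x)) )^{2^{n−i}}. -/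
/-- generalization of Proposition 3 of [Sihem].
Let `p = 2`, `n = r*k`, `f : F_{2^n} → F_{2^k}`, `L` an `F_{2^k}`-linear bijection
of `F_{2^n}` with inverse `Linv`, `g` a bijection of `F_{2^k}` with inverse `ginv`,
and let `γ ≠ 0` be an `(i,a)`-Frobenius translator of `f` with `a ∈ F_{2^k}` nonzero.
Then `φ(x) = L(x) + L(γ)(g(f(x)) + f(x)/a)^{2^{n-i}}` is a permutation of `F_{2^n}`
with inverse `φ⁻¹(x) = Linv(x) + γ a^{-2^{n-i}} (ginv(f(Linv x)/a) + f(Linv x))^{2^{n-i}}`.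
The subfield `F_{2^k}` of `F = F_{2^n}` is identified with `{u : F | u ^ 2 ^ k = u}`. -/
theorem stmt_14 (r k n i : ℕ) (hk : 0 < k) (hn : n = r * k) (hi : i < k)
    (F : Type*) [Field F] [Fintype F] (hF : Fintype.card F = 2 ^ n)
    (f : F → F) (hf : ∀ x, f x ^ 2 ^ k = f x)
    (L Linv : F → F) (hLadd : ∀ x y, L (x + y) = L x + L y)
    (hLsmul : ∀ c x : F, c ^ 2 ^ k = c → L (c * x) = c * L x)
    (hLbij : Function.Bijective L)
    (hLinv : ∀ x, Linv (L x) = x ∧ L (Linv x) = x)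
    (g ginv : F → F)
    (hg : Set.BijOn g {u : F | u ^ 2 ^ k = u} {u : F | u ^ 2 ^ k = u})
    (hginv : ∀ u : F, u ^ 2 ^ k = u →
      ginv u ^ 2 ^ k = ginv u ∧ ginv (g u) = u ∧ g (ginv u) = u)
    (a : F) (ha0 : a ≠ 0) (ha : a ^ 2 ^ k = a)
    (γ : F) (hγ : γ ≠ 0)
    (htr : ∀ x u : F, u ^ 2 ^ k = u → f (x + u * γ) - f x = u ^ 2 ^ i * a)
    (φ φinv : F → F)
    (hφ : ∀ x, φ x = L x + L γ * (g (f x) + f x / a) ^ 2 ^ (n - i))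
    (hφinv : ∀ x, φinv x = Linv x +
      γ * (a ^ 2 ^ (n - i))⁻¹ * (ginv (f (Linv x) / a) + f (Linv x)) ^ 2 ^ (n - i)) :
    Function.Bijective φ ∧ ∀ x : F, φinv (φ x) = x ∧ φ (φinv x) = x := by
  have hn0 : n ≠ 0 := by
    rintro rfl
    exact absurd hF (by simpa using (Fintype.one_lt_card (α := F)).ne')
  have hin : i ≤ n := by
    have hr : 0 < r := Nat.pos_of_ne_zero fun h => hn0 (by simp [hn, h])
    exact hi.le.trans (hn ▸ Nat.le_mul_of_pos_left k hr)
  have two_eq_zero : (2 : F) = 0 := by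
    have h : ((Fintype.card F : ℕ) : F) = 0 := Nat.cast_card_eq_zero F
    rw [hF, Nat.cast_pow] at h
    exact_mod_cast eq_zero_of_pow_eq_zero h
  have : CharP F 2 := CharTwo.of_one_ne_zero_of_two_eq_zero one_ne_zero two_eq_zero
  have pow_twist (v : F) : (v ^ 2 ^ (n - i)) ^ 2 ^ i = v := by
    rw [← pow_mul, ← pow_add, Nat.sub_add_cancel hin, ← hF, FiniteField.pow_card]
  have left_inv (x : F) : φinv (φ x) = x := by
    have hgf : g (f x) ^ 2 ^ k = g (f x) := hg.mapsTo (hf x)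
    set v := g (f x) + f x / a with hv
    have hvk : v ^ 2 ^ k = v := by
      rw [hv, add_pow_char_pow, div_pow, hgf, hf, ha]
    have huk : (v ^ 2 ^ (n - i)) ^ 2 ^ k = v ^ 2 ^ (n - i) := by
      rw [pow_right_comm, hvk]
    have hφx : φ x = L (x + v ^ 2 ^ (n - i) * γ) := by
      rw [hφ, hLadd, hLsmul _ _ huk, mul_comm (L γ)]
    have hfx : f (x + v ^ 2 ^ (n - i) * γ) = a * g (f x) := by
      rw [sub_eq_iff_eq_add.mp (htr x _ huk), pow_twist, hv, add_mul, div_mul_cancel₀ _ ha0,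
        add_assoc, CharTwo.add_self_eq_zero, add_zero, mul_comm]
    have hva : f x + a * g (f x) = a * v := by
      rw [hv, mul_add, mul_div_cancel₀ _ ha0, add_comm]
    rw [hφinv, hφx, (hLinv _).1, hfx, mul_div_cancel_left₀ _ ha0, (hginv _ (hf x)).2.1, hva,
      mul_pow, mul_assoc γ, inv_mul_cancel_left₀ (pow_ne_zero _ ha0), mul_comm γ, add_assoc,
      CharTwo.add_self_eq_zero, add_zero]
  have hbij : Function.Bijective φ :=
    Finite.injective_iff_bijective.mp (Function.LeftInverse.injective left_inv)
  exact ⟨hbij, fun x => ⟨left_inv x,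
    Function.LeftInverse.rightInverse_of_surjective left_inv hbij.surjective x⟩⟩
end

section
/- Let p = 2, n = r·k, let f : F_{2^n} → F_{2^k}, let L : F_{2^n} → F_{2^n} be an F_{2^k}-linear bijection, let g : F_{2^k} → F_{2^k} be a bijection, let a ∈ F_{2^k} be nonzero, and let γ1, γ2, γ3 ∈ F_{2^n} be pairwise distinct nonzero (i,a)-Frobenius translators of f with γ1 + γ2 + γ3 ≠ 0. For j = 1,2,3 define φ_j(x) = L(x) + L(γ_j)·( g(f(x)) + f(x)/a )^{2^{n−i}}. Then ψ = φ_1 + φ_2 + φ_3 is a permutation of F_{2^n}, given by ψ(x) = L(x) + L(γ1+γ2+γ3)·( g(f(x)) + f(x)/a )^{2^{n−i}}, and ψ^{−1} = φ_1^{−1} + φ_2^{−1} + φ_3^{−1}, i.e., the permutations φ_1, φ_2, φ_3 satisfy condition (A_n). -/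
/-- `γ` is an `(i, b)`-Frobenius translator of `f` with respect to the subfield of order `2 ^ k`. -/
def IsFrobeniusTranslator {F : Type*} [Field F] (k i : ℕ) (f : F → F) (b γ : F) : Prop :=
  ∀ x u : F, u ^ 2 ^ k = u → f (x + u * γ) - f x = u ^ 2 ^ i * b

lemma IsFrobeniusTranslator.add_add {F : Type*} [Field F] [CharP F 2] {k i : ℕ} {f : F → F}
    {b γ₁ γ₂ γ₃ : F} (h₁ : IsFrobeniusTranslator k i f b γ₁)
    (h₂ : IsFrobeniusTranslator k i f b γ₂) (h₃ : IsFrobeniusTranslator k i f b γ₃) :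
    IsFrobeniusTranslator k i f b (γ₁ + γ₂ + γ₃) := by
  intro x u hu
  have e₁ := h₁ x u hu
  have e₂ := h₂ (x + u * γ₁) u hu
  have e₃ := h₃ (x + u * γ₁ + u * γ₂) u hu
  have hx : x + u * (γ₁ + γ₂ + γ₃) = x + u * γ₁ + u * γ₂ + u * γ₃ := by ring
  rw [hx]
  linear_combination e₁ + e₂ + e₃ + CharTwo.add_self_eq_zero (u ^ 2 ^ i * b)

/-- If `w` takes values in the subfield of order `2 ^ k` and `w v ^ 2 ^ i * b = b * g v + v` with `g`
injective, then the value of `f` at `x` is determined by `x + w (f x) * γ`, independently of the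
translator `γ`. -/
lemma IsFrobeniusTranslator.apply_eq_of_shift_eq {F : Type*} [Field F] [CharP F 2] {k i : ℕ}
    {f g w : F → F} {b γ δ : F} (hγ : IsFrobeniusTranslator k i f b γ)
    (hδ : IsFrobeniusTranslator k i f b δ) (hb : b ≠ 0) (hf : ∀ x, f x ^ 2 ^ k = f x)
    (hg : Set.InjOn g {u : F | u ^ 2 ^ k = u})
    (hw : ∀ x, w (f x) ^ 2 ^ k = w (f x))
    (hwi : ∀ x, w (f x) ^ 2 ^ i * b = b * g (f x) + f x)
    {x y : F} (hxy : x + w (f x) * γ = y + w (f y) * δ) : f x = f y := by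
  have e₁ := hγ x (w (f x)) (hw x)
  have e₂ := hδ y (w (f y)) (hw y)
  rw [hwi] at e₁ e₂
  rw [hxy] at e₁
  refine hg (hf x) (hf y) (mul_left_cancel₀ hb ?_)
  linear_combination e₂ - e₁ - CharTwo.add_self_eq_zero (f x) + CharTwo.add_self_eq_zero (f y)

/-- With the setting of Statement 14, let `γ1, γ2, γ3` be pairwise
distinct nonzero `(i,a)`-Frobenius translators of `f` with `γ1 + γ2 + γ3 ≠ 0`, and
`φ_j(x) = L(x) + L(γ_j)(g(f(x)) + f(x)/a)^{2^{n-i}}`. Then `ψ = φ1 + φ2 + φ3` is a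
permutation of `F_{2^n}` given by
`ψ(x) = L(x) + L(γ1+γ2+γ3)(g(f(x)) + f(x)/a)^{2^{n-i}}`, and
`ψ⁻¹ = φ1⁻¹ + φ2⁻¹ + φ3⁻¹`, i.e. `φ1, φ2, φ3` satisfy condition `(A_n)`. -/
theorem stmt_15 (r k n i : ℕ) (hk : 0 < k) (hn : n = r * k) (hi : i < k)
    (F : Type*) [Field F] [Fintype F] (hF : Fintype.card F = 2 ^ n)
    (f : F → F) (hf : ∀ x, f x ^ 2 ^ k = f x)
    (L : F → F) (hLadd : ∀ x y, L (x + y) = L x + L y)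
    (hLsmul : ∀ c x : F, c ^ 2 ^ k = c → L (c * x) = c * L x)
    (hLbij : Function.Bijective L)
    (g : F → F)
    (hg : Set.BijOn g {u : F | u ^ 2 ^ k = u} {u : F | u ^ 2 ^ k = u})
    (a : F) (ha0 : a ≠ 0) (ha : a ^ 2 ^ k = a)
    (γ1 γ2 γ3 : F) (hγ1 : γ1 ≠ 0) (hγ2 : γ2 ≠ 0) (hγ3 : γ3 ≠ 0)
    (hne12 : γ1 ≠ γ2) (hne13 : γ1 ≠ γ3) (hne23 : γ2 ≠ γ3)
    (hγsum : γ1 + γ2 + γ3 ≠ 0)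
    (htr1 : ∀ x u : F, u ^ 2 ^ k = u → f (x + u * γ1) - f x = u ^ 2 ^ i * a)
    (htr2 : ∀ x u : F, u ^ 2 ^ k = u → f (x + u * γ2) - f x = u ^ 2 ^ i * a)
    (htr3 : ∀ x u : F, u ^ 2 ^ k = u → f (x + u * γ3) - f x = u ^ 2 ^ i * a)
    (φ1 φ2 φ3 ψ : F → F)
    (hφ1 : ∀ x, φ1 x = L x + L γ1 * (g (f x) + f x / a) ^ 2 ^ (n - i))
    (hφ2 : ∀ x, φ2 x = L x + L γ2 * (g (f x) + f x / a) ^ 2 ^ (n - i))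
    (hφ3 : ∀ x, φ3 x = L x + L γ3 * (g (f x) + f x / a) ^ 2 ^ (n - i))
    (hψ : ∀ x, ψ x = φ1 x + φ2 x + φ3 x) :
    Function.Bijective φ1 ∧ Function.Bijective φ2 ∧ Function.Bijective φ3 ∧
    Function.Bijective ψ ∧
    (∀ x, ψ x = L x + L (γ1 + γ2 + γ3) * (g (f x) + f x / a) ^ 2 ^ (n - i)) ∧
    (∀ x, Function.invFun ψ x =
      Function.invFun φ1 x + Function.invFun φ2 x + Function.invFun φ3 x) := by
  have hn0 : n ≠ 0 := by
    rintro rfl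
    exact absurd hF (by simpa using (Fintype.one_lt_card (α := F)).ne')
  have hin : i ≤ n := by
    have hr : 0 < r := Nat.pos_of_ne_zero (by rintro rfl; simp at hn; exact hn0 hn)
    have := Nat.le_mul_of_pos_left k hr
    omega
  have : Fact (Nat.Prime 2) := ⟨Nat.prime_two⟩
  have : CharP F 2 := charP_of_card_eq_prime_pow hF
  set w : F → F := fun v => (g v + v / a) ^ 2 ^ (n - i) with hwdef
  have hw : ∀ x, w (f x) ^ 2 ^ k = w (f x) := by
    intro x
    have hgx : g (f x) ^ 2 ^ k = g (f x) := hg.mapsTo (hf x)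
    simp only [hwdef]
    rw [pow_right_comm, add_pow_char_pow, div_pow, hgx, hf, ha]
  have hwi : ∀ x, w (f x) ^ 2 ^ i * a = a * g (f x) + f x := by
    intro x
    simp only [hwdef]
    rw [← pow_mul, ← pow_add, Nat.sub_add_cancel hin, ← hF, FiniteField.pow_card]
    field_simp
  have hsum : IsFrobeniusTranslator k i f a (γ1 + γ2 + γ3) :=
    IsFrobeniusTranslator.add_add htr1 htr2 htr3
  have hshift : ∀ γ x, L x + L γ * w (f x) = L (x + w (f x) * γ) := by
    intro γ x
    rw [hLadd, hLsmul _ _ (hw x), mul_comm]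
  have hfeq : ∀ {γ δ x y : F}, IsFrobeniusTranslator k i f a γ →
      IsFrobeniusTranslator k i f a δ → x + w (f x) * γ = y + w (f y) * δ → f x = f y :=
    fun hγ hδ h => hγ.apply_eq_of_shift_eq hδ ha0 hf hg.injOn hw hwi h
  have hbij : ∀ {γ : F} {φ : F → F}, IsFrobeniusTranslator k i f a γ →
      (∀ x, φ x = L (x + w (f x) * γ)) → Function.Bijective φ := by
    intro γ φ hγ hφ
    refine Finite.injective_iff_bijective.mp fun x y hxy => ?_
    rw [hφ, hφ] at hxy
    have h := hLbij.injective hxy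
    rw [hfeq hγ hγ h] at h
    exact add_right_cancel h
  have hφ1' : ∀ x, φ1 x = L (x + w (f x) * γ1) := fun x => (hφ1 x).trans (hshift γ1 x)
  have hφ2' : ∀ x, φ2 x = L (x + w (f x) * γ2) := fun x => (hφ2 x).trans (hshift γ2 x)
  have hφ3' : ∀ x, φ3 x = L (x + w (f x) * γ3) := fun x => (hφ3 x).trans (hshift γ3 x)
  have hψL : ∀ x, ψ x = L x + L (γ1 + γ2 + γ3) * w (f x) := by
    intro x
    rw [hψ, hφ1, hφ2, hφ3, hLadd, hLadd]
    linear_combination CharTwo.add_self_eq_zero (L x)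
  have hψ' : ∀ x, ψ x = L (x + w (f x) * (γ1 + γ2 + γ3)) :=
    fun x => (hψL x).trans (hshift _ x)
  have b1 := hbij htr1 hφ1'
  have b2 := hbij htr2 hφ2'
  have b3 := hbij htr3 hφ3'
  have bψ := hbij hsum hψ'
  refine ⟨b1, b2, b3, bψ, hψL, fun y => ?_⟩
  have r1 := Function.rightInverse_invFun b1.surjective y
  have r2 := Function.rightInverse_invFun b2.surjective y
  have r3 := Function.rightInverse_invFun b3.surjective y
  have rψ := Function.rightInverse_invFun bψ.surjective y
  generalize Function.invFun φ1 y = x1 at *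
  generalize Function.invFun φ2 y = x2 at *
  generalize Function.invFun φ3 y = x3 at *
  generalize Function.invFun ψ y = x0 at *
  rw [hφ1'] at r1
  rw [hφ2'] at r2
  rw [hφ3'] at r3
  rw [hψ'] at rψ
  have e1 := hLbij.injective (r1.trans rψ.symm)
  have e2 := hLbij.injective (r2.trans rψ.symm)
  have e3 := hLbij.injective (r3.trans rψ.symm)
  rw [hfeq htr1 hsum e1] at e1
  rw [hfeq htr2 hsum e2] at e2
  rw [hfeq htr3 hsum e3] at e3
  linear_combination - e1 - e2 - e3 - CharTwo.add_self_eq_zero x0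
    - CharTwo.add_self_eq_zero (w (f x0) * (γ1 + γ2 + γ3))
end

section
/- Let p = 2, n = r·k, let f : F_{2^n} → F_{2^k}, let L : F_{2^n} → F_{2^n} be an F_{2^k}-linear bijection, let g : F_{2^k} → F_{2^k} be a bijection, let a ∈ F_{2^k} be nonzero, and let γ1, γ2, γ3 ∈ F_{2^n} be pairwise distinct nonzero (i,a)-Frobenius translators of f such that γ1 + γ2 + γ3 ≠ 0 is again an (i,a)-Frobenius translator of f. Set ρ(x) = ( g(f(x)) + f(x)/a )^{2^{n−i}} and ρ̃(x) = a^{−2^{n−i}}·( g^{−1}(f(x)/a) + f(x) )^{2^{n−i}}. Then the Boolean function H : F_{2^n} × F_{2^n} → F_2 defined by H(x,y) = Tr(x·L(y)) + Tr(L(γ1)·x·ρ(y))·Tr(L(γ2)·x·ρ(y)) + Tr(L(γ1)·x·ρ(y))·Tr(L(γ3)·x·ρ(y)) + Tr(L(γ2)·x·ρ(y))·Tr(L(γ3)·x·ρ(y)) is bent, and its dual is H*(x,y) = Tr(y·L^{−1}(x)) + Tr(γ1·y·ρ̃(L^{−1}(x)))·Tr(γ2·y·ρ̃(L^{−1}(x)))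 + Tr(γ1·y·ρ̃(L^{−1}(x)))·Tr(γ3·y·ρ̃(L^{−1}(x))) + Tr(γ2·y·ρ̃(L^{−1}(x)))·Tr(γ3·y·ρ̃(L^{−1}(x))); that is, W_H(α,β) = 2^n·(−1)^{H*(α,β)} for all (α,β) ∈ F_{2^n} × F_{2^n}. -/
/-- The sign `(-1) ^ s` of an element `s` of `ZMod 2`. -/
def boolSign (s : ZMod 2) : ℤ := (-1) ^ s.val

lemma boolSign_add (s t : ZMod 2) : boolSign (s + t) = boolSign s * boolSign t := by
  revert s t; decide

lemma two_mul_boolSign_majority (b s t u c : ZMod 2) :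
    2 * boolSign (b + s * t + s * u + t * u + c) =
      boolSign (b + s + c) + boolSign (b + t + c) + boolSign (b + u + c)
        - boolSign (b + (s + t + u) + c) := by
  revert b s t u c; decide

/-- The absolute trace of a finite field of characteristic two, given by its power sum, is additive
and nondegenerate. -/
lemma exists_addMonoidHom_of_trace_pow_sum {F : Type*} [Field F] [Fintype F] [DecidableEq F]
    [CharP F 2] {n : ℕ} (hF : Fintype.card F = 2 ^ n) (tr : F → ZMod 2)
    (htrace : ∀ x, tr x = if (∑ j ∈ Finset.range n, x ^ 2 ^ j) = 0 then 0 else 1) :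
    ∃ T : F →+ ZMod 2, (∀ x, tr x = T x) ∧ ∀ c, c ≠ 0 → ∃ t, T (c * t) = 1 := by
  let _ : Algebra (ZMod 2) F := ZMod.algebra F 2
  have hfin : Module.finrank (ZMod 2) F = n := by
    have h := Module.card_eq_pow_finrank (K := ZMod 2) (V := F)
    rw [hF, ZMod.card] at h
    exact (Nat.pow_right_injective le_rfl h).symm
  have hcases : ∀ s : ZMod 2, s ≠ 0 → s = 1 := by decide
  refine ⟨(Algebra.trace (ZMod 2) F).toAddMonoidHom, fun x => ?_, fun c hc => ?_⟩
  · have h := FiniteField.algebraMap_trace_eq_sum_pow (ZMod 2) F x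
    rw [hfin, Nat.card_zmod] at h
    rw [htrace, ← h]
    by_cases h0 : Algebra.trace (ZMod 2) F x = 0
    · simp [h0]
    · simp [hcases _ h0]
  · obtain ⟨t, ht⟩ := Algebra.trace_surjective (ZMod 2) F 1
    exact ⟨c⁻¹ * t, by simpa [mul_inv_cancel_left₀ hc] using ht⟩

/-- Orthogonality relation for the additive character attached to `T`. -/
lemma sum_boolSign_mul {F : Type*} [Field F] [Fintype F] [DecidableEq F] (T : F →+ ZMod 2)
    (hT : ∀ c, c ≠ 0 → ∃ t, T (c * t) = 1) (c : F) :
    ∑ x : F, boolSign (T (c * x)) = if c = 0 then (Fintype.card F : ℤ) else 0 := by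
  split_ifs with hc
  · simp [hc, boolSign]
  · obtain ⟨t, ht⟩ := hT c hc
    have h : ∑ x : F, boolSign (T (c * (x + t))) = ∑ x : F, boolSign (T (c * x)) :=
      Equiv.sum_comp (Equiv.addRight t) fun x => boolSign (T (c * x))
    have h1 : boolSign 1 = -1 := by decide
    simp only [mul_add, map_add, boolSign_add, ht, h1, ← Finset.sum_mul] at h
    linarith

/-- Walsh transform of the Maiorana–McFarland function `(x, y) ↦ T (x * φ y)`. -/
lemma walsh_maiorana_mcFarland {F : Type*} [Field F] [Fintype F] [DecidableEq F] [CharP F 2]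
    (T : F →+ ZMod 2) (hT : ∀ c, c ≠ 0 → ∃ t, T (c * t) = 1) (φ : F → F) (α β y₀ : F)
    (hφ : ∀ y, φ y = α ↔ y = y₀) :
    ∑ x : F, ∑ y : F, boolSign (T (x * φ y) + (T (α * x) + T (β * y))) =
      Fintype.card F * boolSign (T (β * y₀)) := by
  have h : ∀ x y, boolSign (T (x * φ y) + (T (α * x) + T (β * y))) =
      boolSign (T ((φ y + α) * x)) * boolSign (T (β * y)) := fun x y => by
    rw [← boolSign_add, add_mul, map_add, mul_comm x, add_assoc]
  rw [Finset.sum_comm]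
  simp only [h, ← Finset.sum_mul, sum_boolSign_mul T hT, CharTwo.add_eq_zero, hφ, ite_mul, zero_mul]
  simp

/-- The map `y ↦ L (y + γ * ρ y)` built from a Frobenius translator `γ` takes the value `α` exactly
once, at `Linv α + γ * ρt (Linv α)`. -/
lemma frobenius_translator_preimage_iff {k n i : ℕ} (hin : i ≤ n) {F : Type*} [Field F] [Fintype F]
    [CharP F 2] (hF : Fintype.card F = 2 ^ n) {f : F → F} (hf : ∀ x, f x ^ 2 ^ k = f x)
    {L Linv : F → F} (hLadd : ∀ x y, L (x + y) = L x + L y)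
    (hLsmul : ∀ c x : F, c ^ 2 ^ k = c → L (c * x) = c * L x)
    (hLinv : ∀ x, Linv (L x) = x ∧ L (Linv x) = x) {g ginv : F → F}
    (hg : ∀ u, u ^ 2 ^ k = u → g u ^ 2 ^ k = g u)
    (hginv : ∀ u : F, u ^ 2 ^ k = u →
      ginv u ^ 2 ^ k = ginv u ∧ ginv (g u) = u ∧ g (ginv u) = u)
    {a : F} (ha0 : a ≠ 0) (ha : a ^ 2 ^ k = a) {ρ ρt : F → F}
    (hρ : ∀ x, ρ x = (g (f x) + f x / a) ^ 2 ^ (n - i))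
    (hρt : ∀ x, ρt x = (a ^ 2 ^ (n - i))⁻¹ * (ginv (f x / a) + f x) ^ 2 ^ (n - i))
    {γ : F} (hγ : ∀ x u : F, u ^ 2 ^ k = u → f (x + u * γ) - f x = u ^ 2 ^ i * a) (α y : F) :
    L y + L γ * ρ y = α ↔ y = Linv α + γ * ρt (Linv α) := by
  have hpow : ∀ u : F, (u ^ 2 ^ (n - i)) ^ 2 ^ i = u := fun u => by
    rw [← pow_mul, ← pow_add, Nat.sub_add_cancel hin, ← hF, FiniteField.pow_card]
  have hsub : ∀ (m : ℕ) (u : F), u ^ 2 ^ k = u → (u ^ m) ^ 2 ^ k = u ^ m := fun m u hu => by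
    rw [pow_right_comm, hu]
  have hdiv : ∀ u : F, u ^ 2 ^ k = u → (u / a) ^ 2 ^ k = u / a := fun u hu => by
    rw [div_pow, hu, ha]
  have hadd : ∀ u v : F, u ^ 2 ^ k = u → v ^ 2 ^ k = v → (u + v) ^ 2 ^ k = u + v :=
    fun u v hu hv => by rw [add_pow_char_pow, hu, hv]
  have hρmem : ∀ x, ρ x ^ 2 ^ k = ρ x := fun x => by
    rw [hρ]
    exact hsub _ _ (hadd _ _ (hg _ (hf x)) (hdiv _ (hf x)))
  have hρt' : ∀ x, ρt x = (ginv (f x / a) / a + f x / a) ^ 2 ^ (n - i) := fun x => by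
    rw [hρt, ← add_div, div_pow, div_eq_inv_mul (_ ^ _)]
  have hρtmem : ∀ x, ρt x ^ 2 ^ k = ρt x := fun x => by
    rw [hρt']
    exact hsub _ _ (hadd _ _ (hdiv _ (hginv _ (hdiv _ (hf x))).1) (hdiv _ (hf x)))
  have hφ : ∀ x, L x + L γ * ρ x = L (x + ρ x * γ) := fun x => by
    rw [hLadd, hLsmul _ _ (hρmem x), mul_comm (L γ)]
  have hcancel : ∀ u v : F, u + v + v = u := CharTwo.add_cancel_right
  rw [hφ]
  constructor
  · rintro rfl
    rw [(hLinv _).1]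
    have hfz : f (y + ρ y * γ) = g (f y) * a := by
      rw [eq_add_of_sub_eq (hγ y _ (hρmem y)), hρ, hpow, add_mul, div_mul_cancel₀ _ ha0, hcancel]
    have h : ρt (y + ρ y * γ) = ρ y := by
      rw [hρt', hfz, mul_div_cancel_right₀ _ ha0, (hginv _ (hf y)).2.1, add_comm, ← hρ]
    rw [h, mul_comm γ, hcancel]
  · set z := Linv α with hz
    rintro rfl
    have hfy : f (z + ρt z * γ) = ginv (f z / a) := by
      rw [eq_add_of_sub_eq (hγ z _ (hρtmem z)), hρt', hpow, add_mul, div_mul_cancel₀ _ ha0,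
        div_mul_cancel₀ _ ha0, hcancel]
    have h : ρ (z + ρt z * γ) = ρt z := by
      rw [hρ, hfy, (hginv _ (hdiv _ (hf z))).2.2, add_comm, ← hρt']
    rw [mul_comm γ, h, hcancel, hz, (hLinv α).2]

/-- generalized Theorem 1 of [Sihem].
With `p = 2`, `n = r*k`, `f : F_{2^n} → F_{2^k}`, `L` an `F_{2^k}`-linear bijection with
inverse `Linv`, `g` a bijection of `F_{2^k}` with inverse `ginv`, `a ∈ F_{2^k}` nonzero,
and pairwise distinct nonzero `(i,a)`-Frobenius translators `γ1, γ2, γ3` of `f` whose sum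
is nonzero and again an `(i,a)`-Frobenius translator; with
`ρ(x) = (g(f(x)) + f(x)/a)^{2^{n-i}}` and
`ρ̃(x) = a^{-2^{n-i}} (ginv(f(x)/a) + f(x))^{2^{n-i}}`, the Boolean function
`H(x,y) = Tr(xL(y)) + Tr(L(γ1)xρ(y))Tr(L(γ2)xρ(y)) + Tr(L(γ1)xρ(y))Tr(L(γ3)xρ(y))
 + Tr(L(γ2)xρ(y))Tr(L(γ3)xρ(y))` is bent with dual
`H*(x,y) = Tr(y Linv(x)) + Tr(γ1 y ρ̃(Linv x))Tr(γ2 y ρ̃(Linv x)) + ...`, i.e.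
`W_H(α,β) = 2^n (-1)^{H*(α,β)}` for all `(α,β)`.
Here `Tr : F_{2^n} → F_2` is the absolute trace. -/
theorem stmt_16 (r k n i : ℕ) (hk : 0 < k) (hn : n = r * k) (hi : i < k)
    (F : Type*) [Field F] [Fintype F] [DecidableEq F] (hF : Fintype.card F = 2 ^ n)
    (f : F → F) (hf : ∀ x, f x ^ 2 ^ k = f x)
    (L Linv : F → F) (hLadd : ∀ x y, L (x + y) = L x + L y)
    (hLsmul : ∀ c x : F, c ^ 2 ^ k = c → L (c * x) = c * L x)
    (hLbij : Function.Bijective L)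
    (hLinv : ∀ x, Linv (L x) = x ∧ L (Linv x) = x)
    (g ginv : F → F)
    (hg : Set.BijOn g {u : F | u ^ 2 ^ k = u} {u : F | u ^ 2 ^ k = u})
    (hginv : ∀ u : F, u ^ 2 ^ k = u →
      ginv u ^ 2 ^ k = ginv u ∧ ginv (g u) = u ∧ g (ginv u) = u)
    (a : F) (ha0 : a ≠ 0) (ha : a ^ 2 ^ k = a)
    (γ1 γ2 γ3 : F) (hγ1 : γ1 ≠ 0) (hγ2 : γ2 ≠ 0) (hγ3 : γ3 ≠ 0)
    (hne12 : γ1 ≠ γ2) (hne13 : γ1 ≠ γ3) (hne23 : γ2 ≠ γ3)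
    (hγsum : γ1 + γ2 + γ3 ≠ 0)
    (htr1 : ∀ x u : F, u ^ 2 ^ k = u → f (x + u * γ1) - f x = u ^ 2 ^ i * a)
    (htr2 : ∀ x u : F, u ^ 2 ^ k = u → f (x + u * γ2) - f x = u ^ 2 ^ i * a)
    (htr3 : ∀ x u : F, u ^ 2 ^ k = u → f (x + u * γ3) - f x = u ^ 2 ^ i * a)
    (htrsum : ∀ x u : F, u ^ 2 ^ k = u →
      f (x + u * (γ1 + γ2 + γ3)) - f x = u ^ 2 ^ i * a)
    (ρ ρt : F → F)
    (hρ : ∀ x, ρ x = (g (f x) + f x / a) ^ 2 ^ (n - i))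
    (hρt : ∀ x, ρt x = (a ^ 2 ^ (n - i))⁻¹ * (ginv (f x / a) + f x) ^ 2 ^ (n - i))
    (tr : F → ZMod 2)
    (htrace : ∀ x, tr x = if (∑ j ∈ Finset.range n, x ^ 2 ^ j) = 0 then 0 else 1)
    (H Hstar : F → F → ZMod 2)
    (hH : ∀ x y, H x y = tr (x * L y) +
      tr (L γ1 * x * ρ y) * tr (L γ2 * x * ρ y) +
      tr (L γ1 * x * ρ y) * tr (L γ3 * x * ρ y) +
      tr (L γ2 * x * ρ y) * tr (L γ3 * x * ρ y))
    (hHstar : ∀ x y, Hstar x y = tr (y * Linv x) +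
      tr (γ1 * y * ρt (Linv x)) * tr (γ2 * y * ρt (Linv x)) +
      tr (γ1 * y * ρt (Linv x)) * tr (γ3 * y * ρt (Linv x)) +
      tr (γ2 * y * ρt (Linv x)) * tr (γ3 * y * ρt (Linv x))) :
    ∀ α β : F,
      (∑ x : F, ∑ y : F, (-1 : ℤ) ^ (H x y + tr (α * x) + tr (β * y)).val) =
        2 ^ n * (-1 : ℤ) ^ (Hstar α β).val := by
  intro α β
  have hpos : n ≠ 0 := by
    rintro rfl
    exact absurd hF (by simpa using (Fintype.one_lt_card (α := F)).ne')
  have hin : i ≤ n := by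
    have hr : 0 < r := Nat.pos_of_ne_zero (by rintro rfl; simp [hn] at hpos)
    exact hi.le.trans (hn ▸ Nat.le_mul_of_pos_left k hr)
  have : CharP F 2 := by
    have : Fact (Nat.Prime 2) := ⟨Nat.prime_two⟩
    exact charP_of_card_eq_prime_pow hF
  obtain ⟨T, htrT, hT⟩ := exists_addMonoidHom_of_trace_pow_sum hF tr htrace
  have hW : ∀ γ : F, (∀ x u : F, u ^ 2 ^ k = u → f (x + u * γ) - f x = u ^ 2 ^ i * a) →
      ∑ x : F, ∑ y : F,
        boolSign (T (x * L y) + T (L γ * x * ρ y) + (T (α * x) + T (β * y))) =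
      2 ^ n * boolSign (T (β * Linv α) + T (γ * β * ρt (Linv α)) + 0) := fun γ hγ => by
    have h := walsh_maiorana_mcFarland T hT (fun y => L y + L γ * ρ y) α β _ fun y =>
      frobenius_translator_preimage_iff hin hF hf hLadd hLsmul hLinv
        (fun u hu => hg.mapsTo hu) hginv ha0 ha hρ hρt hγ α y
    rw [hF, mul_add β, map_add, mul_left_comm β, ← mul_assoc γ] at h
    push_cast at h
    rw [add_zero, ← h]
    refine Finset.sum_congr rfl fun x _ => Finset.sum_congr rfl fun y _ => ?_
    rw [← map_add T (x * L y), mul_add x, mul_left_comm x, ← mul_assoc (L γ)]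
  have hsum : ∀ x y, T (L (γ1 + γ2 + γ3) * x * y) =
      T (L γ1 * x * y) + T (L γ2 * x * y) + T (L γ3 * x * y) := fun x y => by
    simp only [hLadd, add_mul, map_add]
  have hsum' : ∀ x y, T ((γ1 + γ2 + γ3) * x * y) =
      T (γ1 * x * y) + T (γ2 * x * y) + T (γ3 * x * y) := fun x y => by
    simp only [add_mul, map_add]
  have h4 := hW _ htrsum
  simp only [hsum, hsum'] at h4
  change ∑ x : F, ∑ y : F, boolSign (H x y + tr (α * x) + tr (β * y)) =
    2 ^ n * boolSign (Hstar α β)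
  refine mul_left_cancel₀ (two_ne_zero (α := ℤ)) ?_
  rw [mul_left_comm, ← add_zero (Hstar α β)]
  simp only [hH, hHstar, htrT, add_assoc (_ + _ * _) (T (α * _)), Finset.mul_sum,
    two_mul_boolSign_majority]
  simp only [Finset.sum_sub_distrib, Finset.sum_add_distrib, mul_sub, mul_add,
    hW _ htr1, hW _ htr2, hW _ htr3, h4]
end

section
/- Let m ≥ 1, let φ1, φ2, φ3 be three pairwise distinct permutations of F_{2^m} satisfying condition (A_n) (so ψ = φ1 + φ2 + φ3 is a permutation and ψ^{−1} = φ1^{−1} + φ2^{−1} + φ3^{−1}), and let h1, h2, h3 : F_{2^m} → F_2 be Boolean functions such that h1(φ1^{−1}(x)) + h2(φ2^{−1}(x)) + h3(φ3^{−1}(x)) + (h1 + h2 + h3)((φ1 + φ2 + φ3)^{−1}(x)) = 1 for all x ∈ F_{2^m}. Define f_i : F_{2^m} × F_{2^m} → F_2 by f_i(x,y) = Tr(x·φ_i(y)) + h_i(y) for i = 1,2,3, and f_4 = f_1 + f_2 + f_3. Then f_1, f_2, f_3, f_4 are all bent and f_1^* + f_2^* + f_3^* + f_4^* = 1 (the constant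 function 1); in particular f_4(x,y) = Tr(x·(φ1+φ2+φ3)(y)) + (h1+h2+h3)(y) and f_4^*(x,y) = Tr(y·(φ1+φ2+φ3)^{−1}(x)) + (h1+h2+h3)((φ1+φ2+φ3)^{−1}(x)). -/
/-- The sign `(-1) ^ a` of a bit `a` turns sums into products. -/
lemma neg_one_pow_val_add (a b : ZMod 2) :
    (-1 : ℤ) ^ (a + b).val = (-1) ^ a.val * (-1) ^ b.val := by
  revert a b; decide

lemma neg_one_pow_val_sum_eq_zero {G : Type*} [AddCommGroup G] [Fintype G]
    (ℓ : G →+ ZMod 2) (hℓ : ∃ z, ℓ z ≠ 0) : ∑ x, (-1 : ℤ) ^ (ℓ x).val = 0 := by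
  obtain ⟨z, hz⟩ := hℓ
  have hz1 : ℓ z = 1 := (by decide : ∀ a : ZMod 2, a ≠ 0 → a = 1) _ hz
  have key : ∑ x, (-1 : ℤ) ^ (ℓ x).val = ∑ x, -(-1 : ℤ) ^ (ℓ x).val := by
    rw [← Equiv.sum_comp (Equiv.addRight z)]
    refine Finset.sum_congr rfl fun x _ => ?_
    rw [Equiv.coe_addRight, map_add, neg_one_pow_val_add, hz1]
    simp [ZMod.val_one]
  rw [Finset.sum_neg_distrib] at key
  linarith

/-- The Walsh transform of a Maiorana–McFarland function `(x, y) ↦ ℓ (x * φ y) + h y`. -/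
lemma walsh_maioranaMcFarland {F : Type*} [Field F] [Fintype F] [CharP F 2]
    (ℓ : F →+ ZMod 2) (hℓ : ∀ c : F, c ≠ 0 → ∃ x, ℓ (c * x) ≠ 0)
    {φ : F → F} (hφ : Function.Bijective φ) (h : F → ZMod 2) (a b : F) :
    ∑ x : F, ∑ y : F, (-1 : ℤ) ^ (ℓ (x * φ y) + h y + ℓ (a * x) + ℓ (b * y)).val =
      Fintype.card F *
        (-1 : ℤ) ^ (ℓ (b * Function.invFun φ a) + h (Function.invFun φ a)).val := by
  have hterm (x y : F) : (-1 : ℤ) ^ (ℓ (x * φ y) + h y + ℓ (a * x) + ℓ (b * y)).val =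
      (-1) ^ (ℓ (b * y) + h y).val * (-1) ^ (ℓ ((φ y + a) * x)).val := by
    rw [← neg_one_pow_val_add, add_mul, map_add, mul_comm x]
    congr 2
    ring
  have hinv : φ (Function.invFun φ a) = a := Function.rightInverse_invFun hφ.2 a
  simp_rw [hterm]
  rw [Finset.sum_comm]
  simp_rw [← Finset.mul_sum]
  rw [Finset.sum_eq_single (Function.invFun φ a)]
  · simp [hinv, CharTwo.add_self_eq_zero, mul_comm]
  · intro y _ hy
    have hc : φ y + a ≠ 0 := fun h0 =>
      hy (hφ.1 ((CharTwo.add_eq_zero.mp h0).trans hinv.symm))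
    exact mul_eq_zero_of_right _
      (neg_one_pow_val_sum_eq_zero (ℓ.comp (AddMonoidHom.mulLeft (φ y + a))) (hℓ _ hc))
  · simp

lemma trace_zmod_two_eq_ite {F : Type*} [Field F] [Fintype F] [DecidableEq F]
    [Algebra (ZMod 2) F] {m : ℕ} (hF : Fintype.card F = 2 ^ m) (x : F) :
    Algebra.trace (ZMod 2) F x =
      if (∑ j ∈ Finset.range m, x ^ 2 ^ j) = 0 then 0 else 1 := by
  have hrank : Module.finrank (ZMod 2) F = m := by
    have := Module.card_eq_pow_finrank (K := ZMod 2) (V := F)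
    rw [hF, ZMod.card] at this
    exact (Nat.pow_right_injective le_rfl this).symm
  have hsum := FiniteField.algebraMap_trace_eq_sum_pow (ZMod 2) F x
  rw [hrank, Nat.card_zmod] at hsum
  simp only [← hsum, FaithfulSMul.algebraMap_eq_zero_iff]
  generalize Algebra.trace (ZMod 2) F x = t
  revert t; decide

/-- solution of the open problem: quadruples of bent functions whose
duals sum to 1. Let `φ1, φ2, φ3` be pairwise distinct permutations of `F_{2^m}`
satisfying condition `(A_n)` (so `ψ = φ1 + φ2 + φ3` is a permutation with
`ψ⁻¹ = φ1⁻¹ + φ2⁻¹ + φ3⁻¹`), and let `h1, h2, h3 : F_{2^m} → F_2` satisfy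
`h1(φ1⁻¹ x) + h2(φ2⁻¹ x) + h3(φ3⁻¹ x) + (h1+h2+h3)(ψ⁻¹ x) = 1` for all `x`.
Then the Maiorana–McFarland functions `f_i(x,y) = Tr(x φ_i(y)) + h_i(y)` (`i = 1,2,3`)
and `f4 = f1 + f2 + f3` are all bent, with the indicated duals `f_i*`, and
`f1* + f2* + f3* + f4* = 1`; in particular
`f4(x,y) = Tr(x ψ(y)) + (h1+h2+h3)(y)` and
`f4*(x,y) = Tr(y ψ⁻¹(x)) + (h1+h2+h3)(ψ⁻¹(x))`. -/
theorem stmt_17 (m : ℕ) (hm : 1 ≤ m)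
    (F : Type*) [Field F] [Fintype F] [DecidableEq F] (hF : Fintype.card F = 2 ^ m)
    (tr : F → ZMod 2)
    (htrace : ∀ x, tr x = if (∑ j ∈ Finset.range m, x ^ 2 ^ j) = 0 then 0 else 1)
    (φ1 φ2 φ3 ψ : F → F)
    (hψ : ∀ y, ψ y = φ1 y + φ2 y + φ3 y)
    (hbij1 : Function.Bijective φ1) (hbij2 : Function.Bijective φ2)
    (hbij3 : Function.Bijective φ3) (hbijψ : Function.Bijective ψ)
    (hne12 : φ1 ≠ φ2) (hne13 : φ1 ≠ φ3) (hne23 : φ2 ≠ φ3)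
    (hAn : ∀ x, Function.invFun ψ x =
      Function.invFun φ1 x + Function.invFun φ2 x + Function.invFun φ3 x)
    (h1 h2 h3 : F → ZMod 2)
    (hcond : ∀ x, h1 (Function.invFun φ1 x) + h2 (Function.invFun φ2 x) +
      h3 (Function.invFun φ3 x) +
      (h1 (Function.invFun ψ x) + h2 (Function.invFun ψ x) + h3 (Function.invFun ψ x)) = 1)
    (f1 f2 f3 f4 : F → F → ZMod 2)
    (hf1 : ∀ x y, f1 x y = tr (x * φ1 y) + h1 y)
    (hf2 : ∀ x y, f2 x y = tr (x * φ2 y) + h2 y)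
    (hf3 : ∀ x y, f3 x y = tr (x * φ3 y) + h3 y)
    (hf4 : ∀ x y, f4 x y = f1 x y + f2 x y + f3 x y)
    (fs1 fs2 fs3 fs4 : F → F → ZMod 2)
    (hfs1 : ∀ x y, fs1 x y = tr (y * Function.invFun φ1 x) + h1 (Function.invFun φ1 x))
    (hfs2 : ∀ x y, fs2 x y = tr (y * Function.invFun φ2 x) + h2 (Function.invFun φ2 x))
    (hfs3 : ∀ x y, fs3 x y = tr (y * Function.invFun φ3 x) + h3 (Function.invFun φ3 x))
    (hfs4 : ∀ x y, fs4 x y = tr (y * Function.invFun ψ x) +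
      (h1 (Function.invFun ψ x) + h2 (Function.invFun ψ x) + h3 (Function.invFun ψ x))) :
    (∀ a b : F,
      (∑ x : F, ∑ y : F, (-1 : ℤ) ^ (f1 x y + tr (a * x) + tr (b * y)).val) =
        2 ^ m * (-1 : ℤ) ^ (fs1 a b).val) ∧
    (∀ a b : F,
      (∑ x : F, ∑ y : F, (-1 : ℤ) ^ (f2 x y + tr (a * x) + tr (b * y)).val) =
        2 ^ m * (-1 : ℤ) ^ (fs2 a b).val) ∧
    (∀ a b : F,
      (∑ x : F, ∑ y : F, (-1 : ℤ) ^ (f3 x y + tr (a * x) + tr (b * y)).val) =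
        2 ^ m * (-1 : ℤ) ^ (fs3 a b).val) ∧
    (∀ a b : F,
      (∑ x : F, ∑ y : F, (-1 : ℤ) ^ (f4 x y + tr (a * x) + tr (b * y)).val) =
        2 ^ m * (-1 : ℤ) ^ (fs4 a b).val) ∧
    (∀ x y : F, fs1 x y + fs2 x y + fs3 x y + fs4 x y = 1) ∧
    (∀ x y : F, f4 x y = tr (x * ψ y) + (h1 y + h2 y + h3 y)) := by
  have : CharP F 2 := by
    have : Fact (Nat.Prime 2) := ⟨Nat.prime_two⟩
    exact charP_of_card_eq_prime_pow hF
  let _ : Algebra (ZMod 2) F := ZMod.algebra F 2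
  obtain ⟨ℓ, hsurj, rfl⟩ : ∃ ℓ : F →+ ZMod 2, Function.Surjective ℓ ∧ tr = ℓ :=
    ⟨(Algebra.trace (ZMod 2) F).toAddMonoidHom, Algebra.trace_surjective (ZMod 2) F,
      funext fun x => (htrace x).trans (trace_zmod_two_eq_ite hF x).symm⟩
  have hℓ (c : F) (hc : c ≠ 0) : ∃ x, ℓ (c * x) ≠ 0 := by
    obtain ⟨x, hx⟩ := hsurj 1
    exact ⟨c⁻¹ * x, by simp [mul_inv_cancel_left₀ hc, hx]⟩
  have hcard : (Fintype.card F : ℤ) = 2 ^ m := by exact_mod_cast hF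
  have hf4' (x y : F) : f4 x y = ℓ (x * ψ y) + (h1 y + h2 y + h3 y) := by
    rw [hf4, hf1, hf2, hf3, hψ, mul_add, mul_add, map_add, map_add]
    ring
  refine ⟨fun a b => ?_, fun a b => ?_, fun a b => ?_, fun a b => ?_, fun x y => ?_, hf4'⟩
  · simp_rw [hf1, hfs1, ← hcard]
    exact walsh_maioranaMcFarland ℓ hℓ hbij1 h1 a b
  · simp_rw [hf2, hfs2, ← hcard]
    exact walsh_maioranaMcFarland ℓ hℓ hbij2 h2 a b
  · simp_rw [hf3, hfs3, ← hcard]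
    exact walsh_maioranaMcFarland ℓ hℓ hbij3 h3 a b
  · simp_rw [hf4', hfs4, ← hcard]
    exact walsh_maioranaMcFarland ℓ hℓ hbijψ (fun y => h1 y + h2 y + h3 y) a b
  · rw [← hcond x, hfs1, hfs2, hfs3, hfs4]
    have htr : ℓ (y * Function.invFun ψ x) = ℓ (y * Function.invFun φ1 x) +
        ℓ (y * Function.invFun φ2 x) + ℓ (y * Function.invFun φ3 x) := by
      rw [hAn, mul_add, mul_add, map_add, map_add]
    linear_combination htr + CharTwo.add_self_eq_zero (ℓ (y * Function.invFun φ1 x) +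
        ℓ (y * Function.invFun φ2 x) + ℓ (y * Function.invFun φ3 x))
end

section
/- Let p = 2, n = r·k with k > 1, let f : F_{2^n} → F_{2^k}, let g : F_{2^k} → F_{2^k} be arbitrary, and let γ1, γ2, γ3 ∈ F_{2^n} be pairwise distinct nonzero 0-linear translators of f (i.e., f(x + uγ_j) = f(x) for all x ∈ F_{2^n}, u ∈ F_{2^k}) with γ1 + γ2 + γ3 ≠ 0. Define F_j(x) = x + γ_j·g(f(x)) for j = 1,2,3. Then each F_j is an involution of F_{2^n}, the sum F_1 + F_2 + F_3, given by x ↦ x + (γ1+γ2+γ3)·g(f(x)), is again an involution (hence a permutation) of F_{2^n}, and (F_1 + F_2 + F_3)^{−1} = F_1^{−1} + F_2^{−1} + F_3^{−1}; that is, F_1, F_2, F_3 satisfy condition (A_n). -/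
theorem two_eq_zero_of_card_eq_two_pow {F : Type*} [Field F] [Fintype F] {n : ℕ}
    (hF : Fintype.card F = 2 ^ n) : (2 : F) = 0 := by
  have h : ((Fintype.card F : ℕ) : F) = 0 := Nat.cast_card_eq_zero F
  rw [hF] at h
  push_cast at h
  exact eq_zero_of_pow_eq_zero h

/-- In characteristic two, adding a multiple of `γ` by a quantity that is invariant under
that addition is an involution. -/
theorem involutive_add_mul {F : Type*} [CommRing F] (h2 : (2 : F) = 0) {γ : F} {h G : F → F}
    (hG : ∀ x, G x = x + γ * h x) (hinv : ∀ x, h (x + γ * h x) = h x) :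
    Function.Involutive G := fun x => by
  rw [hG (G x), hG x, hinv]
  linear_combination γ * h x * h2

theorem Function.Involutive.invFun_eq {α : Type*} [Nonempty α] {φ : α → α}
    (hφ : Function.Involutive φ) : Function.invFun φ = φ :=
  Function.invFun_eq_of_injective_of_rightInverse hφ.injective hφ

/-- For `p = 2`, `n = r*k` (`k > 1`), `f : F_{2^n} → F_{2^k}`,
arbitrary `g : F_{2^k} → F_{2^k}` and pairwise distinct nonzero `0`-linear translators
`γ1, γ2, γ3` of `f` with `γ1 + γ2 + γ3 ≠ 0`, the maps `F_j(x) = x + γ_j g(f(x))` are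
involutions of `F_{2^n}`, their sum `x ↦ x + (γ1+γ2+γ3) g(f(x))` is again an involution
(hence a permutation), and `(F1+F2+F3)⁻¹ = F1⁻¹ + F2⁻¹ + F3⁻¹`, i.e. `F1, F2, F3`
satisfy condition `(A_n)`.
The subfield `F_{2^k}` of `F = F_{2^n}` is identified with `{u : F | u ^ 2 ^ k = u}`. -/
theorem stmt_18 (r k n : ℕ) (hk : 1 < k) (hn : n = r * k)
    (F : Type*) [Field F] [Fintype F] (hF : Fintype.card F = 2 ^ n)
    (f : F → F) (hf : ∀ x, f x ^ 2 ^ k = f x)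
    (g : F → F) (hg : ∀ u : F, u ^ 2 ^ k = u → g u ^ 2 ^ k = g u)
    (γ1 γ2 γ3 : F) (hγ1 : γ1 ≠ 0) (hγ2 : γ2 ≠ 0) (hγ3 : γ3 ≠ 0)
    (hne12 : γ1 ≠ γ2) (hne13 : γ1 ≠ γ3) (hne23 : γ2 ≠ γ3)
    (hγsum : γ1 + γ2 + γ3 ≠ 0)
    (htr1 : ∀ x u : F, u ^ 2 ^ k = u → f (x + u * γ1) = f x)
    (htr2 : ∀ x u : F, u ^ 2 ^ k = u → f (x + u * γ2) = f x)
    (htr3 : ∀ x u : F, u ^ 2 ^ k = u → f (x + u * γ3) = f x)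
    (F1 F2 F3 Fs : F → F)
    (hF1 : ∀ x, F1 x = x + γ1 * g (f x))
    (hF2 : ∀ x, F2 x = x + γ2 * g (f x))
    (hF3 : ∀ x, F3 x = x + γ3 * g (f x))
    (hFs : ∀ x, Fs x = F1 x + F2 x + F3 x) :
    (∀ x, F1 (F1 x) = x) ∧ (∀ x, F2 (F2 x) = x) ∧ (∀ x, F3 (F3 x) = x) ∧
    (∀ x, Fs x = x + (γ1 + γ2 + γ3) * g (f x)) ∧
    (∀ x, Fs (Fs x) = x) ∧ Function.Bijective Fs ∧
    (∀ x, Function.invFun Fs x =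
      Function.invFun F1 x + Function.invFun F2 x + Function.invFun F3 x) := by
  have h2 := two_eq_zero_of_card_eq_two_pow hF
  have hgf : ∀ x, g (f x) ^ 2 ^ k = g (f x) := fun x => hg _ (hf x)
  have inv1 : Function.Involutive F1 := involutive_add_mul h2 hF1 fun x => by
    rw [mul_comm, htr1 _ _ (hgf x)]
  have inv2 : Function.Involutive F2 := involutive_add_mul h2 hF2 fun x => by
    rw [mul_comm, htr2 _ _ (hgf x)]
  have inv3 : Function.Involutive F3 := involutive_add_mul h2 hF3 fun x => by
    rw [mul_comm, htr3 _ _ (hgf x)]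
  have hsum : ∀ x, Fs x = x + (γ1 + γ2 + γ3) * g (f x) := fun x => by
    rw [hFs, hF1, hF2, hF3]
    linear_combination x * h2
  have invs : Function.Involutive Fs := involutive_add_mul h2 hsum fun x => by
    rw [mul_comm, mul_add, mul_add, ← add_assoc, ← add_assoc,
      htr3 _ _ (hgf x), htr2 _ _ (hgf x), htr1 _ _ (hgf x)]
  refine ⟨inv1, inv2, inv3, hsum, invs, invs.bijective, fun x => ?_⟩
  rw [invs.invFun_eq, inv1.invFun_eq, inv2.invFun_eq, inv3.invFun_eq, hFs]
end
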